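/- arXiv:1311.0853 — 3 statements merged into one kernel-verified Lean document; each statement's English description precedes it below -/
import Mathlib

section
/- Quantum Lax pair for the deformed rational CMS system: the matrices L, M, H over End_ℂ(F) satisfy [L, H] = [L, M], i.e., L_{ij}∘H_{n,m} − H_{n,m}∘L_{ij} = Σ_{a} (L_{ia}∘M_{aj} − M_{ia}∘L_{aj}) for all 1 ≤ i, j ≤ n+m. -/
open Polynomial MvPolynomial

noncomputable section

variable (n m : ℕ)

/-- the polynomial ring ℂ[x₁,…,x_{n+m}] -/
abbrev PR (n m : ℕ) : Type := MvPolynomial (Fin (n + m)) ℂ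
/-- F = ℂ(x₁,…,x_{n+m}), the field of rational functions -/
abbrev F (n m : ℕ) : Type := FractionRing (PR n m)

/-- the embedding ℂ[x₁,…,x_{n+m}] → ℂ(x₁,…,x_{n+m}) -/
def emb (f : PR n m) : F n m := algebraMap _ _ f

/-- image of x_i in F -/
def xi (i : Fin (n + m)) : F n m := emb n m (MvPolynomial.X i)

/-- image of a constant c ∈ ℂ in F -/
def cc (c : ℂ) : F n m := emb n m (MvPolynomial.C c)

/-- the parity p(i): 0 for the first n indices, 1 for the last m (valued in ℤ,
so that k^{p(i)}, k^{1−p(j)}, k^{−p(i)} make sense as zpow in the field F). -/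
def pE (i : Fin (n + m)) : ℤ := if (i : ℕ) < n then 0 else 1

/-- numerator of a chosen fraction representation of z ∈ F -/
def num (z : F n m) : PR n m :=
  (IsLocalization.sec (nonZeroDivisors (PR n m)) z).1

/-- denominator of a chosen fraction representation of z ∈ F -/
def den (z : F n m) : PR n m :=
  ((IsLocalization.sec (nonZeroDivisors (PR n m)) z).2 : PR n m)

/-- the partial derivative ∂/∂x_i on the field of rational functions F,
extending `MvPolynomial.pderiv i` by the quotient rule.  (Since z = num z / den z
for any z, this is exactly the unique extension of ∂/∂x_i to F.) -/
def fder (i : Fin (n + m)) (z : F n m) : F n m :=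
  (emb n m (pderiv i (num n m z)) * emb n m (den n m z)
    - emb n m (num n m z) * emb n m (pderiv i (den n m z)))
  / (emb n m (den n m z)) ^ 2

end

noncomputable section
variable (n m : ℕ) (k : ℂ)

/-- the quantum Moser matrix L of the deformed rational CMS system:
L_{ii} = k^{p(i)} ∂/∂x_i, and for i ≠ j, L_{ij} = multiplication by
k^{1−p(j)}/(x_i − x_j); entries are ℂ-linear operators on F, given as functions. -/
def Lmat (i j : Fin (n + m)) : F n m → F n m :=
  if i = j then fun z => (cc n m k) ^ (pE n m i) * fder n m i z
  else fun z => (cc n m k) ^ (1 - pE n m j) * (xi n m i - xi n m j)⁻¹ * z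

/-- the matrix M: for i ≠ j, M_{ij} = multiplication by 2k^{1−p(j)}/(x_i − x_j)², and
M_{ii} = −Σ_{j≠i} multiplication by 2k^{1−p(j)}/(x_i − x_j)². -/
def Mmat (i j : Fin (n + m)) : F n m → F n m :=
  if i = j then
    fun z => -(∑ l ∈ Finset.univ.erase i,
        2 * (cc n m k) ^ (1 - pE n m l) * ((xi n m i - xi n m l) ^ 2)⁻¹) * z
  else fun z => 2 * (cc n m k) ^ (1 - pE n m j) * ((xi n m i - xi n m j) ^ 2)⁻¹ * z

/-- the deformed rational CMS operator H_{n,m} (with the inverse-square potential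
terms acting by multiplication). -/
def Hnm (z : F n m) : F n m :=
  (∑ i ∈ Finset.univ.filter (fun i : Fin (n + m) => (i : ℕ) < n),
      fder n m i (fder n m i z))
  + cc n m k * (∑ j ∈ Finset.univ.filter (fun j : Fin (n + m) => n ≤ (j : ℕ)),
      fder n m j (fder n m j z))
  - (∑ i : Fin (n + m), ∑ j : Fin (n + m),
      if (i : ℕ) < (j : ℕ) ∧ (j : ℕ) < n then
        2 * cc n m k * (cc n m k + 1) * ((xi n m i - xi n m j) ^ 2)⁻¹ else 0) * z
  - (∑ i : Fin (n + m), ∑ j : Fin (n + m),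
      if n ≤ (i : ℕ) ∧ (i : ℕ) < (j : ℕ) then
        2 * ((cc n m k)⁻¹ + 1) * ((xi n m i - xi n m j) ^ 2)⁻¹ else 0) * z
  - (∑ i : Fin (n + m), ∑ j : Fin (n + m),
      if (i : ℕ) < n ∧ n ≤ (j : ℕ) then
        2 * (cc n m k + 1) * ((xi n m i - xi n m j) ^ 2)⁻¹ else 0) * z

end

section CommutingDerivations

variable {R K ι : Type*} [CommRing R] [Field K] [Algebra R K] [DecidableEq ι]
  {D : ι → Derivation R K K} {x : ι → K}

/-- Coordinate derivations act on `(x a - x b)⁻¹` by the expected formula; it also holds for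
`a = b`, where the inverse is `0`. -/
theorem derivation_inv_sub (hx : ∀ a b, D a (x b) = if a = b then 1 else 0) (i a b : ι) :
    D i (x a - x b)⁻¹ =
      ((if i = b then 1 else 0) - (if i = a then 1 else 0)) * ((x a - x b)⁻¹) ^ 2 := by
  rw [Derivation.leibniz_inv, map_sub, hx, hx, smul_eq_mul]
  ring

theorem derivation_inv_sub_sq (hx : ∀ a b, D a (x b) = if a = b then 1 else 0) (i a b : ι) :
    D i (((x a - x b)⁻¹) ^ 2) =
      2 * ((if i = b then 1 else 0) - (if i = a then 1 else 0)) * ((x a - x b)⁻¹) ^ 3 := by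
  rw [pow_two, Derivation.leibniz, derivation_inv_sub hx, smul_eq_mul]
  ring

theorem derivation_const_mul {d : Derivation R K K} {c : K} (hc : d c = 0) (f : K) :
    d (c * f) = c * d f := by
  rw [Derivation.leibniz, hc, smul_zero, add_zero, smul_eq_mul]

theorem derivation_zpow_eq_zero {d : Derivation R K K} {c : K} (hc : d c = 0) (e : ℤ) :
    d (c ^ e) = 0 := by
  rw [Derivation.leibniz_zpow, hc, smul_zero, smul_zero]

theorem inv_sub_symm (a b : K) : (a - b)⁻¹ = -(b - a)⁻¹ := by
  rw [← neg_sub b a, inv_neg]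

theorem inv_sub_sq_symm (a b : K) : ((a - b)⁻¹) ^ 2 = ((b - a)⁻¹) ^ 2 := by
  rw [inv_sub_symm, neg_sq]

theorem inv_sub_pow_three_symm (a b : K) : ((a - b)⁻¹) ^ 3 = -((b - a)⁻¹) ^ 3 := by
  rw [inv_sub_symm]
  ring

variable [Fintype ι]

/-- The gradient of the inverse-square potential. -/
theorem derivation_potential (hx : ∀ a b, D a (x b) = if a = b then 1 else 0)
    {c : ι → K} (hc : ∀ a b, D a (c b) = 0) (i : ι) :
    D i (∑ a, ∑ b, c a * c b * ((x a - x b)⁻¹) ^ 2) =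
      -(4 * c i * ∑ b, c b * ((x i - x b)⁻¹) ^ 3) := by
  have hcc (a b : ι) : D i (c a * c b) = 0 := by
    rw [derivation_const_mul (hc i a), hc, mul_zero]
  have h (a b : ι) : D i (c a * c b * ((x a - x b)⁻¹) ^ 2) =
      (if i = b then -(2 * c i * (c a * ((x i - x a)⁻¹) ^ 3)) else 0) +
        (if i = a then -(2 * c i * (c b * ((x i - x b)⁻¹) ^ 3)) else 0) := by
    rw [derivation_const_mul (hcc a b), derivation_inv_sub_sq hx]
    split_ifs with h1 h2 h2
    · subst h1; subst h2; simp
    · subst h1; rw [inv_sub_pow_three_symm (x a)]; ring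
    · subst h2; ring
    · ring
  simp only [map_sum, h, Finset.sum_add_distrib, Finset.sum_ite_eq, Finset.mem_univ, if_true]
  rw [Finset.sum_comm (f := fun a b => if i = a then _ else _)]
  simp only [Finset.sum_ite_eq, Finset.mem_univ, if_true, Finset.sum_neg_distrib,
    ← Finset.mul_sum]
  ring

/-- The three-point identity behind the off-diagonal part of the Lax equation. -/
theorem inv_sub_three_point {a b c : K} (hac : a ≠ c) (hab : a ≠ b) (hbc : b ≠ c) :
    (a - b)⁻¹ * ((b - c)⁻¹) ^ 2 - ((a - b)⁻¹) ^ 2 * (b - c)⁻¹ =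
      (a - c)⁻¹ * (((c - b)⁻¹) ^ 2 - ((a - b)⁻¹) ^ 2) := by
  have h1 := sub_ne_zero.mpr hac
  have h2 := sub_ne_zero.mpr hab
  have h3 := sub_ne_zero.mpr hbc
  have h4 := sub_ne_zero.mpr hbc.symm
  field_simp
  ring

theorem sum_three_point (hinj : Function.Injective x) (c : ι → K) {i j : ι} (hij : i ≠ j) :
    ∑ a, c a * ((x i - x a)⁻¹ * ((x a - x j)⁻¹) ^ 2 - ((x i - x a)⁻¹) ^ 2 * (x a - x j)⁻¹) =
      (x i - x j)⁻¹ * (∑ a, c a * ((x j - x a)⁻¹) ^ 2 - ∑ a, c a * ((x i - x a)⁻¹) ^ 2)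
        + (c j - c i) * ((x i - x j)⁻¹) ^ 3 := by
  have h (a : ι) : c a * ((x i - x a)⁻¹ * ((x a - x j)⁻¹) ^ 2
        - ((x i - x a)⁻¹) ^ 2 * (x a - x j)⁻¹) =
      (x i - x j)⁻¹ * (c a * ((x j - x a)⁻¹) ^ 2 - c a * ((x i - x a)⁻¹) ^ 2)
        + ((if a = j then c j * ((x i - x j)⁻¹) ^ 3 else 0)
          - (if a = i then c i * ((x i - x j)⁻¹) ^ 3 else 0)) := by
    by_cases hj : a = j
    · subst hj
      simp only [sub_self, inv_zero, if_true, if_neg hij.symm]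
      ring
    by_cases hi : a = i
    · subst hi
      simp only [sub_self, inv_zero, if_true, if_neg hij, inv_sub_sq_symm (x j) (x a)]
      ring
    · rw [inv_sub_three_point (hinj.ne hij) (hinj.ne (Ne.symm hi)) (hinj.ne hj), if_neg hi,
        if_neg hj]
      ring
  simp only [h, Finset.sum_add_distrib, Finset.sum_sub_distrib, ← Finset.mul_sum,
    Finset.sum_ite_eq', Finset.mem_univ, if_true]
  ring

variable {κ c : ι → K} {k : K}

/-- The diagonal part of the Lax equation. -/
theorem lax_diagonal (hx : ∀ a b, D a (x b) = if a = b then 1 else 0)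
    (hcomm : ∀ a b z, D a (D b z) = D b (D a z)) (hk : k ≠ 0) (hkD : ∀ a, D a k = 0)
    (hκD : ∀ a b, D a (κ b) = 0) (hcD : ∀ a b, D a (c b) = 0)
    (hmul : ∀ a, κ a * c a = k) (hadd : ∀ a, κ a + c a = 1 + k) (U : K)
    (hU : U = (1 + k⁻¹) * ∑ a, ∑ b, c a * c b * ((x a - x b)⁻¹) ^ 2) (i : ι) (z : K) :
    κ i * D i (∑ a, κ a * D a (D a z) - U * z)
        - (∑ a, κ a * D a (D a (κ i * D i z)) - U * (κ i * D i z)) =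
      κ i * D i (-(2 * ∑ a, c a * ((x i - x a)⁻¹) ^ 2) * z)
        + 2 * (∑ a, c a * ((x i - x a)⁻¹) ^ 2) * (κ i * D i z)
        + ∑ a, 4 * c i * (c a * ((x i - x a)⁻¹) ^ 3) * z := by
  have hkin : D i (∑ a, κ a * D a (D a z)) * κ i = ∑ a, κ a * D a (D a (κ i * D i z)) := by
    rw [map_sum, Finset.sum_mul]
    refine Finset.sum_congr rfl fun a _ => ?_
    rw [derivation_const_mul (hκD _ _), derivation_const_mul (hκD _ _),
      derivation_const_mul (hκD _ _), hcomm i a, hcomm i a]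
    ring
  have hk' : D i (1 + k⁻¹) = 0 := by
    rw [map_add, Derivation.leibniz_inv, hkD, Derivation.map_one_eq_zero, smul_zero, add_zero]
  have hUD : D i U = -((1 + k⁻¹) * (4 * c i * ∑ b, c b * ((x i - x b)⁻¹) ^ 3)) := by
    rw [hU, derivation_const_mul hk', derivation_potential hx hcD]
    ring
  have hW : D i (∑ a, c a * ((x i - x a)⁻¹) ^ 2) = -(2 * ∑ b, c b * ((x i - x b)⁻¹) ^ 3) := by
    rw [map_sum, Finset.mul_sum, ← Finset.sum_neg_distrib]
    refine Finset.sum_congr rfl fun a _ => ?_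
    rw [derivation_const_mul (hcD _ _), derivation_inv_sub_sq hx]
    by_cases h : i = a
    · subst h; simp
    · rw [if_neg h, if_pos rfl]; ring
  have h2 : D i (2 : K) = 0 := by
    rw [← one_add_one_eq_two, map_add, Derivation.map_one_eq_zero, add_zero]
  rw [← hkin, map_sub, Derivation.leibniz _ U, Derivation.leibniz _ (-_), hUD, map_neg,
    derivation_const_mul h2, hW]
  simp only [smul_eq_mul, ← Finset.sum_mul, ← Finset.mul_sum]
  generalize ∑ b, c b * ((x i - x b)⁻¹) ^ 3 = S
  have hinv : κ i * (1 + k⁻¹) * c i = κ i + c i := by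
    rw [hadd, mul_right_comm, hmul]
    field_simp
    ring
  linear_combination (4 * z * S) * hinv

/-- The off-diagonal part of the Lax equation. -/
theorem lax_off_diagonal (hx : ∀ a b, D a (x b) = if a = b then 1 else 0)
    (hinj : Function.Injective x) (hcD : ∀ a b, D a (c b) = 0)
    (hadd : ∀ a, κ a + c a = 1 + k) (U : K) {i j : ι} (hij : i ≠ j) (z : K) :
    c j * (x i - x j)⁻¹ * (∑ a, κ a * D a (D a z) - U * z)
        - (∑ a, κ a * D a (D a (c j * (x i - x j)⁻¹ * z)) - U * (c j * (x i - x j)⁻¹ * z)) =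
      κ i * D i (2 * c j * ((x i - x j)⁻¹) ^ 2 * z)
        - 2 * c j * ((x i - x j)⁻¹) ^ 2 * (κ j * D j z)
        - c j * (x i - x j)⁻¹ * (2 * (∑ a, c a * ((x j - x a)⁻¹) ^ 2) * z)
        + 2 * (∑ a, c a * ((x i - x a)⁻¹) ^ 2) * (c j * (x i - x j)⁻¹ * z)
        + ∑ a, 2 * c j * (c a * ((x i - x a)⁻¹ * ((x a - x j)⁻¹) ^ 2
            - ((x i - x a)⁻¹) ^ 2 * (x a - x j)⁻¹)) * z := by
  have h2 : D i (2 : K) = 0 := by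
    rw [← one_add_one_eq_two, map_add, Derivation.map_one_eq_zero, add_zero]
  have h2c : D i (2 * c j) = 0 := by rw [derivation_const_mul h2, hcD, mul_zero]
  have hterm (a : ι) : κ a * D a (D a (c j * (x i - x j)⁻¹ * z)) =
      c j * (x i - x j)⁻¹ * (κ a * D a (D a z))
        + ((if a = i then c j * κ i * (2 * ((x i - x j)⁻¹) ^ 3 * z
            - 2 * ((x i - x j)⁻¹) ^ 2 * D i z) else 0)
          + (if a = j then c j * κ j * (2 * ((x i - x j)⁻¹) ^ 3 * z
            + 2 * ((x i - x j)⁻¹) ^ 2 * D j z) else 0)) := by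
    rw [mul_assoc (c j), derivation_const_mul (hcD _ _), derivation_const_mul (hcD _ _),
      Derivation.leibniz, map_add, smul_eq_mul, smul_eq_mul, Derivation.leibniz,
      Derivation.leibniz _ z, derivation_inv_sub hx]
    by_cases hi : a = i
    · subst hi
      simp only [if_true, if_neg hij, zero_sub, neg_one_mul, map_neg, smul_eq_mul,
        derivation_inv_sub_sq hx]
      ring
    by_cases hj : a = j
    · subst hj
      simp only [if_true, if_neg hi, sub_zero, one_mul, smul_eq_mul, derivation_inv_sub_sq hx]
      ring
    · simp only [if_neg hi, if_neg hj, sub_zero, zero_mul, map_zero, smul_eq_mul]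
      ring
  rw [mul_assoc (2 * c j) _ z, derivation_const_mul h2c, Derivation.leibniz,
    derivation_inv_sub_sq hx, if_neg hij, if_pos rfl]
  simp only [hterm, Finset.sum_add_distrib, ← Finset.sum_mul, ← Finset.mul_sum,
    Finset.sum_ite_eq', Finset.mem_univ, if_true, smul_eq_mul, sum_three_point hinj c hij]
  linear_combination (2 * c j * ((x i - x j)⁻¹) ^ 3 * z) * (hadd i - hadd j)

end CommutingDerivations

section RationalFunctions

variable {n m : ℕ}

theorem emb_eq_algebraMap (p : PR n m) : emb n m p = algebraMap (PR n m) (F n m) p := rfl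

theorem emb_ne_zero {p : PR n m} (hp : p ≠ 0) : emb n m p ≠ 0 :=
  (map_ne_zero_iff _ (IsFractionRing.injective (PR n m) (F n m))).mpr hp

theorem den_ne_zero (z : F n m) : den n m z ≠ 0 :=
  nonZeroDivisors.ne_zero (IsLocalization.sec (nonZeroDivisors (PR n m)) z).2.2

theorem mul_emb_den (z : F n m) : z * emb n m (den n m z) = emb n m (num n m z) :=
  IsLocalization.sec_spec _ z

theorem exists_emb_div (z : F n m) : ∃ p q : PR n m, q ≠ 0 ∧ z = emb n m p / emb n m q :=
  ⟨num n m z, den n m z, den_ne_zero z,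
    (eq_div_iff (emb_ne_zero (den_ne_zero z))).mpr (mul_emb_den z)⟩

/-- The quotient rule does not depend on the chosen fraction. -/
theorem fder_div (i : Fin (n + m)) (p : PR n m) {q : PR n m} (hq : q ≠ 0) :
    fder n m i (emb n m p / emb n m q) =
      (emb n m (pderiv i p) * emb n m q - emb n m p * emb n m (pderiv i q)) / emb n m q ^ 2 := by
  set z := emb n m p / emb n m q with hz
  have hq' := emb_ne_zero hq
  have hd' := emb_ne_zero (den_ne_zero z)
  have hzq : z * emb n m q = emb n m p := div_mul_cancel₀ _ hq'
  have hzd := mul_emb_den z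
  have hcross : num n m z * q = p * den n m z := by
    apply IsFractionRing.injective (PR n m) (F n m)
    rw [map_mul, map_mul]
    simp only [← emb_eq_algebraMap]
    rw [← hzq, ← hzd]
    ring
  have hder := congrArg (fun r => emb n m (pderiv i r)) hcross
  simp only [Derivation.leibniz, smul_eq_mul, emb_eq_algebraMap, map_add, map_mul] at hder
  simp only [← emb_eq_algebraMap] at hder
  rw [fder, div_eq_div_iff (pow_ne_zero 2 hd') (pow_ne_zero 2 hq')]
  rw [← hzd, ← hzq] at hder ⊢
  linear_combination (emb n m q * emb n m (den n m z)) * hder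

theorem fder_emb (i : Fin (n + m)) (p : PR n m) :
    fder n m i (emb n m p) = emb n m (pderiv i p) := by
  simpa [emb_eq_algebraMap] using fder_div i p (one_ne_zero : (1 : PR n m) ≠ 0)

theorem fder_add (i : Fin (n + m)) (y z : F n m) :
    fder n m i (y + z) = fder n m i y + fder n m i z := by
  obtain ⟨p, q, hq, rfl⟩ := exists_emb_div y
  obtain ⟨r, s, hs, rfl⟩ := exists_emb_div z
  have hq' := emb_ne_zero hq
  have hs' := emb_ne_zero hs
  have h : emb n m p / emb n m q + emb n m r / emb n m s =
      emb n m (p * s + q * r) / emb n m (q * s) := by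
    simp only [emb_eq_algebraMap, map_add, map_mul] at hq' hs' ⊢
    exact div_add_div _ _ hq' hs'
  rw [h, fder_div i _ (mul_ne_zero hq hs), fder_div i _ hq, fder_div i _ hs]
  simp only [emb_eq_algebraMap, map_add, map_mul, Derivation.leibniz, smul_eq_mul] at hq' hs' ⊢
  field_simp
  ring

theorem fder_mul (i : Fin (n + m)) (y z : F n m) :
    fder n m i (y * z) = y * fder n m i z + z * fder n m i y := by
  obtain ⟨p, q, hq, rfl⟩ := exists_emb_div y
  obtain ⟨r, s, hs, rfl⟩ := exists_emb_div z
  have hq' := emb_ne_zero hq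
  have hs' := emb_ne_zero hs
  have h : emb n m p / emb n m q * (emb n m r / emb n m s) =
      emb n m (p * r) / emb n m (q * s) := by
    simp only [emb_eq_algebraMap, map_mul]
    exact div_mul_div_comm _ _ _ _
  rw [h, fder_div i _ (mul_ne_zero hq hs), fder_div i _ hq, fder_div i _ hs]
  simp only [emb_eq_algebraMap, map_add, map_mul, Derivation.leibniz, smul_eq_mul] at hq' hs' ⊢
  field_simp
  ring

theorem smul_eq_cc_mul (c : ℂ) (z : F n m) : c • z = cc n m c * z := by
  rw [Algebra.smul_def, IsScalarTower.algebraMap_apply ℂ (PR n m) (F n m)]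
  rfl

theorem fder_cc (i : Fin (n + m)) (c : ℂ) : fder n m i (cc n m c) = 0 := by
  rw [cc, fder_emb, pderiv_C, emb_eq_algebraMap, map_zero]

/-- `fder n m i` as a derivation of the field of rational functions. -/
noncomputable def fderDerivation (i : Fin (n + m)) : Derivation ℂ (F n m) (F n m) :=
  Derivation.mk'
    { toFun := fder n m i
      map_add' := fder_add i
      map_smul' := fun c z => by
        simp only [smul_eq_cc_mul, fder_mul, fder_cc, mul_zero, add_zero, RingHom.id_apply] }
    (fder_mul i)

@[simp]
theorem fderDerivation_apply (i : Fin (n + m)) (z : F n m) :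
    fderDerivation i z = fder n m i z := rfl

/-- A derivation vanishing on polynomials vanishes on rational functions. -/
theorem derivation_eq_zero_of_emb (d : Derivation ℂ (F n m) (F n m))
    (hd : ∀ p, d (emb n m p) = 0) (z : F n m) : d z = 0 := by
  obtain ⟨p, q, -, rfl⟩ := exists_emb_div z
  rw [Derivation.leibniz_div, hd, hd]
  simp

theorem pderiv_comm {σ R : Type*} [CommRing R] (a b : σ) (p : MvPolynomial σ R) :
    pderiv a (pderiv b p) = pderiv b (pderiv a p) := by
  classical
  have h : ⁅(pderiv a : Derivation R (MvPolynomial σ R) (MvPolynomial σ R)),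
      (pderiv b : Derivation R (MvPolynomial σ R) (MvPolynomial σ R))⁆ = 0 := by
    refine MvPolynomial.derivation_ext fun c => ?_
    rw [Derivation.commutator_apply, pderiv_X, pderiv_X]
    simp [Pi.single_apply, apply_ite]
  have h' := congrArg (fun d : Derivation R _ _ => d p) h
  rwa [Derivation.commutator_apply, Derivation.zero_apply, sub_eq_zero] at h'

theorem fder_comm (a b : Fin (n + m)) (z : F n m) :
    fder n m a (fder n m b z) = fder n m b (fder n m a z) := by
  have h := derivation_eq_zero_of_emb ⁅fderDerivation a, fderDerivation b⁆ (fun p => by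
    rw [Derivation.commutator_apply]
    simp only [fderDerivation_apply, fder_emb]
    rw [pderiv_comm, sub_self]) z
  rwa [Derivation.commutator_apply, sub_eq_zero] at h

theorem fderDerivation_xi (a b : Fin (n + m)) :
    fderDerivation a (xi n m b) = if a = b then 1 else 0 := by
  rw [fderDerivation_apply, xi, fder_emb, pderiv_X, Pi.single_apply, emb_eq_algebraMap]
  split_ifs with h1 h2 h2 <;> simp_all

theorem fderDerivation_cc (a : Fin (n + m)) (c : ℂ) : fderDerivation a (cc n m c) = 0 :=
  fder_cc a c

theorem xi_injective : Function.Injective (xi n m) := fun _ _ h =>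
  MvPolynomial.X_injective (IsFractionRing.injective (PR n m) (F n m) h)

theorem cc_ne_zero {k : ℂ} (hk : k ≠ 0) : cc n m k ≠ 0 :=
  emb_ne_zero ((map_ne_zero_iff _ (MvPolynomial.C_injective _ _)).mpr hk)

theorem fderDerivation_cc_zpow (a : Fin (n + m)) (k : ℂ) (e : ℤ) :
    fderDerivation a (cc n m k ^ e) = 0 :=
  derivation_zpow_eq_zero (fderDerivation_cc a k) e

variable {k : ℂ}

theorem Lmat_apply (i j : Fin (n + m)) (z : F n m) :
    Lmat n m k i j z = (if i = j then cc n m k ^ pE n m i * fder n m i z else 0) +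
      cc n m k ^ (1 - pE n m j) * (xi n m i - xi n m j)⁻¹ * z := by
  by_cases h : i = j
  · subst h; simp [Lmat]
  · simp [Lmat, h]

theorem Mmat_apply (i j : Fin (n + m)) (z : F n m) :
    Mmat n m k i j z =
      2 * cc n m k ^ (1 - pE n m j) * ((xi n m i - xi n m j)⁻¹) ^ 2 * z -
        (if i = j then
          2 * (∑ l, cc n m k ^ (1 - pE n m l) * ((xi n m i - xi n m l)⁻¹) ^ 2) * z else 0) := by
  by_cases h : i = j
  · subst h
    rw [Mmat, if_pos rfl, if_pos rfl, Finset.sum_erase _ (by simp), Finset.mul_sum]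
    simp [mul_assoc]
  · simp [Mmat, h]

theorem sum_Lmat_Mmat (i j : Fin (n + m)) (z : F n m) :
    ∑ a, (Lmat n m k i a (Mmat n m k a j z) - Mmat n m k i a (Lmat n m k a j z)) =
      cc n m k ^ pE n m i * fder n m i (Mmat n m k i j z)
        - cc n m k ^ (1 - pE n m j) * (xi n m i - xi n m j)⁻¹ *
          (2 * (∑ l, cc n m k ^ (1 - pE n m l) * ((xi n m j - xi n m l)⁻¹) ^ 2) * z)
        + 2 * (∑ l, cc n m k ^ (1 - pE n m l) * ((xi n m i - xi n m l)⁻¹) ^ 2) *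
          Lmat n m k i j z
        - 2 * cc n m k ^ (1 - pE n m j) * ((xi n m i - xi n m j)⁻¹) ^ 2 *
          (cc n m k ^ pE n m j * fder n m j z)
        + ∑ a, 2 * cc n m k ^ (1 - pE n m j) * (cc n m k ^ (1 - pE n m a) *
          ((xi n m i - xi n m a)⁻¹ * ((xi n m a - xi n m j)⁻¹) ^ 2
            - ((xi n m i - xi n m a)⁻¹) ^ 2 * (xi n m a - xi n m j)⁻¹)) * z := by
  have h (a : Fin (n + m)) :
      Lmat n m k i a (Mmat n m k a j z) - Mmat n m k i a (Lmat n m k a j z) =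
      (if i = a then cc n m k ^ pE n m i * fder n m i (Mmat n m k i j z) else 0)
      - (if a = j then cc n m k ^ (1 - pE n m j) * (xi n m i - xi n m j)⁻¹ *
          (2 * (∑ l, cc n m k ^ (1 - pE n m l) * ((xi n m j - xi n m l)⁻¹) ^ 2) * z) else 0)
      + (if i = a then 2 * (∑ l, cc n m k ^ (1 - pE n m l) *
          ((xi n m i - xi n m l)⁻¹) ^ 2) * Lmat n m k i j z else 0)
      - (if a = j then 2 * cc n m k ^ (1 - pE n m j) * ((xi n m i - xi n m j)⁻¹) ^ 2 *
          (cc n m k ^ pE n m j * fder n m j z) else 0)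
      + 2 * cc n m k ^ (1 - pE n m j) * (cc n m k ^ (1 - pE n m a) *
          ((xi n m i - xi n m a)⁻¹ * ((xi n m a - xi n m j)⁻¹) ^ 2
            - ((xi n m i - xi n m a)⁻¹) ^ 2 * (xi n m a - xi n m j)⁻¹)) * z := by
    rw [Lmat_apply i a, Mmat_apply i a]
    have hL : (cc n m k ^ (1 - pE n m a) * (xi n m i - xi n m a)⁻¹ * Mmat n m k a j z) =
      cc n m k ^ (1 - pE n m a) * (xi n m i - xi n m a)⁻¹ *
        (2 * cc n m k ^ (1 - pE n m j) * ((xi n m a - xi n m j)⁻¹) ^ 2 * z)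
      - (if a = j then cc n m k ^ (1 - pE n m j) * (xi n m i - xi n m j)⁻¹ *
          (2 * (∑ l, cc n m k ^ (1 - pE n m l) * ((xi n m j - xi n m l)⁻¹) ^ 2) * z)
          else 0) := by
      rw [Mmat_apply a j]
      split_ifs with h
      · subst h; ring
      · ring
    have hM : 2 * cc n m k ^ (1 - pE n m a) * ((xi n m i - xi n m a)⁻¹) ^ 2 *
          Lmat n m k a j z =
        2 * cc n m k ^ (1 - pE n m a) * ((xi n m i - xi n m a)⁻¹) ^ 2 *
          (cc n m k ^ (1 - pE n m j) * (xi n m a - xi n m j)⁻¹ * z)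
        + (if a = j then 2 * cc n m k ^ (1 - pE n m j) * ((xi n m i - xi n m j)⁻¹) ^ 2 *
          (cc n m k ^ pE n m j * fder n m j z) else 0) := by
      rw [Lmat_apply a j]
      split_ifs with h
      · subst h; ring
      · ring
    rw [hL, hM]
    by_cases hi : i = a
    · subst hi
      simp only [if_true]
      ring
    · simp only [if_neg hi]
      ring
  simp only [h, Finset.sum_add_distrib, Finset.sum_sub_distrib, Finset.sum_ite_eq,
    Finset.sum_ite_eq', Finset.mem_univ, if_true]

/-- The operator `Hnm` with kinetic and potential terms written as uniform sums over all
indices. -/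
theorem Hnm_apply (hk : k ≠ 0) (z : F n m) :
    Hnm n m k z = ∑ a, cc n m k ^ pE n m a * fder n m a (fder n m a z) -
      ((1 + (cc n m k)⁻¹) * ∑ a, ∑ b, cc n m k ^ (1 - pE n m a) * cc n m k ^ (1 - pE n m b) *
        ((xi n m a - xi n m b)⁻¹) ^ 2) * z := by
  have hk' := cc_ne_zero (n := n) (m := m) hk
  have hkin : ∑ a, cc n m k ^ pE n m a * fder n m a (fder n m a z) =
      (∑ i ∈ Finset.univ.filter (fun i : Fin (n + m) => (i : ℕ) < n),
        fder n m i (fder n m i z))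
      + cc n m k * (∑ j ∈ Finset.univ.filter (fun j : Fin (n + m) => n ≤ (j : ℕ)),
        fder n m j (fder n m j z)) := by
    rw [Finset.mul_sum, Finset.sum_filter, Finset.sum_filter, ← Finset.sum_add_distrib]
    refine Finset.sum_congr rfl fun a _ => ?_
    by_cases h : (a : ℕ) < n
    · simp [pE, h]
    · simp [pE, h, not_lt.mp h]
  -- Each unordered pair is counted twice in the uniform sum and once in `Hnm`.
  set P : Fin (n + m) → Fin (n + m) → F n m := fun a b =>
    (1 + (cc n m k)⁻¹) * (cc n m k ^ (1 - pE n m a) * cc n m k ^ (1 - pE n m b) *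
        ((xi n m a - xi n m b)⁻¹) ^ 2) with hP
  have hsymm (a b) : P a b = P b a := by
    simp only [hP, inv_sub_sq_symm (xi n m a) (xi n m b)]
    ring
  have hsplit : ∑ a, ∑ b, P a b = ∑ a, ∑ b, if a < b then 2 * P a b else 0 := by
    have h (a b) : P a b = (if a < b then P a b else 0) + (if b < a then P b a else 0) := by
      rcases lt_trichotomy a b with h | h | h
      · simp [h, h.not_gt]
      · subst h; simp [hP]
      · simp [h, h.not_gt, hsymm a b]
    have hs : ∑ a, ∑ b, P a b = (∑ a, ∑ b, if a < b then P a b else 0)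
        + ∑ a, ∑ b, if b < a then P b a else 0 := by
      simp only [← Finset.sum_add_distrib, ← h]
    rw [hs, Finset.sum_comm (f := fun a b => if b < a then P b a else 0)]
    simp only [← Finset.sum_add_distrib]
    refine Finset.sum_congr rfl fun a _ => Finset.sum_congr rfl fun b _ => ?_
    split_ifs <;> ring
  rw [Hnm, ← hkin, sub_sub, sub_sub, ← add_mul, ← add_mul]
  congr 2
  simp only [Finset.mul_sum]
  rw [hsplit]
  simp only [← Finset.sum_add_distrib]
  refine Finset.sum_congr rfl fun a _ => Finset.sum_congr rfl fun b _ => ?_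
  by_cases ha : (a : ℕ) < n <;> by_cases hb : (b : ℕ) < n <;> by_cases hab : a < b <;>
    have hab' := hab <;> rw [Fin.lt_def] at hab' <;>
    simp only [hP, pE, ha, hb, hab, hab', not_lt.mp, if_true, if_false, and_true,
      and_false, add_zero, zero_add, sub_zero, sub_self, zpow_zero, zpow_one, one_mul,
      inv_pow, ← not_lt, not_true, not_false_eq_true]
  all_goals first | omega | (field_simp; ring) | field_simp

end RationalFunctions

/-- quantum Lax pair for the deformed rational CMS system:
[L, H] = [L, M] entrywise, where H is the diagonal matrix with each diagonal entry the
deformed rational CMS operator H_{n,m}. -/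
theorem quantum_Lax_pair_deformed_rational (n m : ℕ) (k : ℂ) (hk : k ≠ 0)
    (i j : Fin (n + m)) (z : F n m) :
    Lmat n m k i j (Hnm n m k z) - Hnm n m k (Lmat n m k i j z) =
      ∑ a : Fin (n + m),
        (Lmat n m k i a (Mmat n m k a j z) - Mmat n m k i a (Lmat n m k a j z)) := by
  have hk' := cc_ne_zero (n := n) (m := m) hk
  have hmul (a : Fin (n + m)) : cc n m k ^ pE n m a * cc n m k ^ (1 - pE n m a) = cc n m k := by
    rw [← zpow_add₀ hk', add_sub_cancel, zpow_one]
  have hadd (a : Fin (n + m)) :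
      cc n m k ^ pE n m a + cc n m k ^ (1 - pE n m a) = 1 + cc n m k := by
    unfold pE
    split_ifs <;> simp [add_comm]
  rw [sum_Lmat_Mmat, Hnm_apply hk, Hnm_apply hk, Lmat_apply, Lmat_apply, Mmat_apply]
  by_cases hij : i = j
  · subst hij
    have h := lax_diagonal (D := fderDerivation) fderDerivation_xi fder_comm hk'
      (fderDerivation_cc · k) (fun a b => fderDerivation_cc_zpow a k (pE n m b))
      (fun a b => fderDerivation_cc_zpow a k (1 - pE n m b)) hmul hadd _ rfl i z
    simp only [fderDerivation_apply] at h
    simp only [if_true, sub_self, inv_zero, mul_zero, zero_mul, add_zero, zero_sub, sub_zero,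
      ne_eq, OfNat.ofNat_ne_zero, not_false_eq_true, zero_pow]
    rw [h, neg_mul]
    congr 1
    refine Finset.sum_congr rfl fun a _ => ?_
    rw [inv_sub_symm (xi n m a) (xi n m i)]
    ring
  · have h := lax_off_diagonal (D := fderDerivation) fderDerivation_xi xi_injective
      (fun a b => fderDerivation_cc_zpow a k (1 - pE n m b)) hadd
      ((1 + (cc n m k)⁻¹) * ∑ a, ∑ b, cc n m k ^ (1 - pE n m a) * cc n m k ^ (1 - pE n m b) *
        ((xi n m a - xi n m b)⁻¹) ^ 2) hij z
    simp only [fderDerivation_apply] at h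
    simp only [if_neg hij, zero_add, sub_zero]
    rw [h]
    ring
end

section
/- For every r ≥ 1, the operator L^{(r)}_{n,m} = Σ_{i,j=1}^{n+m} k^{−p(i)}·(L^r)_{ij} (the deformed total trace of the r-th power of the quantum Moser matrix, i.e., e*·L^r·e with e the all-ones column vector and e*_i = k^{−p(i)}) commutes with the deformed rational CMS operator: [L^{(r)}_{n,m}, H_{n,m}] = 0 in End_ℂ(F). -/
open Polynomial MvPolynomial

noncomputable section

/-- product of matrices of operators: (A·B)_{ij} = Σ_a A_{ia} ∘ B_{aj}. -/
def mmul {ι α : Type*} [Fintype ι] [AddCommMonoid α]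
    (A B : ι → ι → (α → α)) : ι → ι → (α → α) :=
  fun i j z => ∑ a, A i a (B a j z)

/-- power of a matrix of operators (the 0-th power is the identity matrix). -/
def mpow {ι α : Type*} [Fintype ι] [DecidableEq ι] [AddCommMonoid α]
    (A : ι → ι → (α → α)) : ℕ → ι → ι → (α → α)
  | 0 => fun i j z => if i = j then z else 0
  | r + 1 => mmul A (mpow A r)

/-- L^{(r)}_{n,m} = Σ_{i,j} k^{−p(i)} (L^r)_{ij} = e*·L^r·e, the deformed total trace of
the r-th power of the quantum Moser matrix. -/
def Lop (n m : ℕ) (k : ℂ) (r : ℕ) (z : F n m) : F n m :=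
  ∑ i : Fin (n + m), ∑ j : Fin (n + m),
    (cc n m k) ^ (-(pE n m i)) * mpow (Lmat n m k) r i j z

end

namespace DeformedCMS

section Abstract

variable {ι K : Type*} [DecidableEq ι] [Field K]

/-- The data of a deformed rational CMS system over a field `K`: commuting derivations `D i` dual
to the coordinates `x i`, and constants `k`, `w i` with `k * w i + (w i)⁻¹ = k + 1`. -/
structure Data (ι K : Type*) [DecidableEq ι] [Field K] where
  /-- the partial derivatives -/
  D : ι → Derivation ℤ K K
  /-- the coordinates -/
  x : ι → K
  /-- the coupling constant -/
  k : K
  /-- the weights of the deformed total trace -/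
  w : ι → K
  comm : ∀ i j z, D i (D j z) = D j (D i z)
  D_x : ∀ i j, D i (x j) = if i = j then 1 else 0
  x_ne : ∀ i j, i ≠ j → x i - x j ≠ 0
  w_ne : ∀ i, w i ≠ 0
  D_k : ∀ i, D i k = 0
  D_w : ∀ i j, D i (w j) = 0
  add_eq : ∀ i, k * w i + (w i)⁻¹ = k + 1

namespace Data

variable (S : Data ι K)

/-- The reciprocal difference of two coordinates; it vanishes for equal indices. -/
def u (i j : ι) : K := (S.x i - S.x j)⁻¹

lemma u_self (i : ι) : S.u i i = 0 := by simp [u]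

lemma u_swap (i j : ι) : S.u j i = -S.u i j := by
  rw [u, u, ← inv_neg, neg_sub]

lemma D_u (a i j : ι) : S.D a (S.u i j) =
    ((if a = j then 1 else 0) - if a = i then 1 else 0) * S.u i j ^ 2 := by
  simp only [u, Derivation.leibniz_inv, map_sub, S.D_x, smul_eq_mul]
  ring

lemma D_inv_w (i j : ι) : S.D i (S.w j)⁻¹ = 0 := by
  simp [Derivation.leibniz_inv, S.D_w]

lemma u_mul_add {i j a : ι} (hij : i ≠ j) (hia : i ≠ a) (haj : a ≠ j) :
    S.u i j * (S.u i a + S.u a j) = S.u i a * S.u a j := by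
  have h1 := S.x_ne i j hij
  have h2 := S.x_ne i a hia
  have h3 := S.x_ne a j haj
  simp only [u]
  field_simp
  ring

lemma D_u_sq (a i j : ι) : S.D a (S.u i j ^ 2) =
    ((if a = j then 1 else 0) - if a = i then 1 else 0) * (2 * S.u i j ^ 3) := by
  rw [pow_two, Derivation.leibniz, D_u]
  simp only [smul_eq_mul]
  ring

/-- The quantum Moser matrix. -/
def L : Matrix ι ι (Module.End ℤ K) := fun i j =>
  { toFun := fun z => (if i = j then (S.w i)⁻¹ * S.D i z else 0) + S.k * S.w j * S.u i j * z
    map_add' := fun y z => by split_ifs <;> simp <;> ring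
    map_smul' := fun t z => by split_ifs <;> simp <;> ring }

lemma L_apply (i j : ι) (z : K) : S.L i j z =
    (if i = j then (S.w i)⁻¹ * S.D i z else 0) + S.k * S.w j * S.u i j * z := rfl

variable [Fintype ι]

/-- The potential of the deformed CMS operator. -/
def W : K := -∑ a, ∑ b, S.k * (S.k + 1) * (S.w a * S.w b * S.u a b ^ 2)

/-- The deformed CMS operator. -/
def H : Module.End ℤ K where
  toFun z := ∑ a, (S.w a)⁻¹ * S.D a (S.D a z) + S.W * z
  map_add' y z := by
    simp only [map_add, mul_add, Finset.sum_add_distrib]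
    ring
  map_smul' t z := by
    simp [Finset.mul_sum, mul_left_comm]

/-- The second matrix of the quantum Lax pair. -/
def M : Matrix ι ι (Module.End ℤ K) := fun i j =>
  LinearMap.mulLeft ℤ (2 * S.k * S.w j * S.u i j ^ 2
    - if i = j then ∑ l, 2 * S.k * S.w l * S.u i l ^ 2 else 0)

lemma H_apply (z : K) : S.H z = ∑ a, (S.w a)⁻¹ * S.D a (S.D a z) + S.W * z := rfl

lemma M_apply (i j : ι) (z : K) : S.M i j z = (2 * S.k * S.w j * S.u i j ^ 2
    - if i = j then ∑ l, 2 * S.k * S.w l * S.u i l ^ 2 else 0) * z := rfl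

lemma D_W (i : ι) :
    S.D i S.W = 4 * S.k * (S.k + 1) * S.w i * ∑ l, S.w l * S.u i l ^ 3 := by
  have h : ∀ a b, S.D i (S.k * (S.k + 1) * (S.w a * S.w b * S.u a b ^ 2)) =
      (if i = b then 2 * S.k * (S.k + 1) * S.w a * S.w b * S.u a b ^ 3 else 0)
      - (if i = a then 2 * S.k * (S.k + 1) * S.w a * S.w b * S.u a b ^ 3 else 0) := by
    intro a b
    simp only [Derivation.leibniz, map_add, D_u_sq, S.D_w, S.D_k, Derivation.map_one_eq_zero,
      smul_eq_mul]
    split_ifs <;> ring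
  simp only [W, map_neg, map_sum, h, Finset.sum_sub_distrib, Finset.sum_ite_eq, Finset.mem_univ,
    if_true]
  rw [Finset.sum_comm (f := fun a b => if i = a then _ else _)]
  simp only [Finset.sum_ite_eq, Finset.mem_univ, if_true]
  rw [← Finset.sum_sub_distrib, ← Finset.sum_neg_distrib, Finset.mul_sum]
  refine Finset.sum_congr rfl fun l _ => ?_
  rw [S.u_swap i l]
  ring

lemma D_M_diag (i : ι) : S.D i (∑ l, 2 * S.k * S.w l * S.u i l ^ 2) =
    -(4 * S.k * ∑ l, S.w l * S.u i l ^ 3) := by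
  rw [map_sum, Finset.mul_sum, ← Finset.sum_neg_distrib]
  refine Finset.sum_congr rfl fun l _ => ?_
  have h2 : S.D i (2 : K) = 0 := by exact_mod_cast (S.D i).map_natCast 2
  simp only [Derivation.leibniz, D_u_sq, S.D_w, S.D_k, h2, smul_eq_mul, if_true]
  by_cases h : i = l
  · subst h
    simp [u_self]
  · simp only [h, if_false]
    ring

lemma H_mul_of_const {c : K} (hc : ∀ a, S.D a c = 0) (z : K) : S.H (c * z) = c * S.H z := by
  simp only [H_apply, Derivation.leibniz, hc, smul_eq_mul, mul_zero, add_zero, mul_add,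
    Finset.mul_sum, mul_left_comm]

lemma D_H (i : ι) (z : K) : S.D i (S.H z) - S.H (S.D i z) = S.D i S.W * z := by
  simp only [H_apply, map_add, map_sum, Derivation.leibniz, D_inv_w, smul_eq_mul, mul_zero,
    add_zero, S.comm i]
  ring

lemma lax_diag (i : ι) (z : K) :
    S.L i i (S.H z) - S.H (S.L i i z) =
      ∑ a, (S.L i a (S.M a i z) - S.M i a (S.L a i z)) := by
  have h : ∀ a, S.L i a (S.M a i z) - S.M i a (S.L a i z) =
      4 * S.k ^ 2 * S.w i * (S.w a * S.u i a ^ 3) * z +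
      if i = a then -(S.w i)⁻¹ * S.D i (∑ l, 2 * S.k * S.w l * S.u i l ^ 2) * z else 0 := by
    intro a
    simp only [L_apply, M_apply]
    by_cases ha : i = a
    · subst ha
      simp only [if_true, u_self, Derivation.leibniz, smul_eq_mul, map_sub, mul_zero, zero_mul,
        ne_eq, OfNat.ofNat_ne_zero, not_false_eq_true, zero_pow, map_zero]
      ring
    · simp only [ha, Ne.symm ha, if_false]
      rw [S.u_swap i a]
      ring
  simp only [h, Finset.sum_add_distrib, Finset.sum_ite_eq, Finset.mem_univ, if_true, D_M_diag]
  rw [← Finset.sum_mul, ← Finset.mul_sum]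
  simp only [L_apply, if_true, u_self, mul_zero, zero_mul, add_zero]
  rw [S.H_mul_of_const (fun a => S.D_inv_w a i), ← mul_sub, D_H, D_W, ← S.add_eq i]
  have hw := S.w_ne i
  field_simp

lemma H_mul_u {i j : ι} (hij : i ≠ j) (z : K) :
    S.H (S.k * S.w j * S.u i j * z) = S.k * S.w j * S.u i j * S.H z
      + 2 * S.k * S.w j * ((S.w i)⁻¹ + (S.w j)⁻¹) * S.u i j ^ 3 * z
      + 2 * S.k * S.w j * S.u i j ^ 2 * ((S.w j)⁻¹ * S.D j z - (S.w i)⁻¹ * S.D i z) := by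
  have h0 : ∀ a, S.D a (S.k * S.w j) = 0 := fun a => by simp [S.D_k, S.D_w]
  have h : ∀ a, (S.w a)⁻¹ * S.D a (S.D a (S.u i j * z)) =
      S.u i j * ((S.w a)⁻¹ * S.D a (S.D a z))
      + (if a = j then (S.w j)⁻¹ * (2 * S.u i j ^ 3 * z + 2 * S.u i j ^ 2 * S.D j z) else 0)
      + if a = i then (S.w i)⁻¹ * (2 * S.u i j ^ 3 * z - 2 * S.u i j ^ 2 * S.D i z) else 0 := by
    intro a
    by_cases hj : a = j
    · subst hj
      simp only [Derivation.leibniz, smul_eq_mul, map_add, D_u, D_u_sq, hij.symm, if_true, if_false,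
        sub_zero, one_mul]
      ring
    · by_cases hi : a = i
      · subst hi
        simp only [Derivation.leibniz, smul_eq_mul, map_add, D_u, D_u_sq, hij, if_true,
          if_false, zero_sub, neg_mul, one_mul, map_neg, add_zero]
        ring
      · simp only [Derivation.leibniz, smul_eq_mul, D_u, hi, hj, if_false, sub_zero,
          zero_mul, mul_zero, add_zero]
        ring
  rw [mul_assoc (S.k * S.w j), S.H_mul_of_const h0]
  simp only [H_apply, h, Finset.sum_add_distrib, ← Finset.mul_sum, Finset.sum_ite_eq',
    Finset.mem_univ, if_true]
  ring

lemma sum_w_mul_u {i j : ι} (hij : i ≠ j) :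
    ∑ a, S.w a * (S.u i a * S.u a j ^ 2 - S.u i a ^ 2 * S.u a j
      + S.u i j * (S.u i a ^ 2 - S.u j a ^ 2)) = (S.w j - S.w i) * S.u i j ^ 3 := by
  have h : ∀ a, S.w a * (S.u i a * S.u a j ^ 2 - S.u i a ^ 2 * S.u a j
      + S.u i j * (S.u i a ^ 2 - S.u j a ^ 2)) =
      (if a = j then S.w j * S.u i j ^ 3 else 0) - if a = i then S.w i * S.u i j ^ 3 else 0 := by
    intro a
    by_cases hj : a = j
    · subst hj
      simp only [hij.symm, if_true, if_false, u_self]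
      ring
    · by_cases hi : a = i
      · subst hi
        simp only [hij, if_true, if_false, u_self, S.u_swap a j]
        ring
      · simp only [hi, hj, if_false, S.u_swap a j]
        linear_combination S.w a * (S.u i a - S.u a j) * S.u_mul_add hij (Ne.symm hi) hj
  simp only [h, Finset.sum_sub_distrib, Finset.sum_ite_eq', Finset.mem_univ, if_true]
  ring

lemma lax_off_diag {i j : ι} (hij : i ≠ j) (z : K) :
    S.L i j (S.H z) - S.H (S.L i j z) =
      ∑ a, (S.L i a (S.M a j z) - S.M i a (S.L a j z)) := by
  have h : ∀ a, S.L i a (S.M a j z) - S.M i a (S.L a j z) =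
      2 * S.k ^ 2 * S.w j * (S.w a * (S.u i a * S.u a j ^ 2 - S.u i a ^ 2 * S.u a j)) * z
      + (if a = i then (S.w i)⁻¹ * (2 * S.k * S.w j) *
          (S.u i j ^ 2 * S.D i z - 2 * S.u i j ^ 3 * z)
          + S.k * S.w j * S.u i j * (∑ l, 2 * S.k * S.w l * S.u i l ^ 2) * z else 0)
      - (if a = j then 2 * S.k * S.w j * S.u i j ^ 2 * ((S.w j)⁻¹ * S.D j z)
          + S.k * S.w j * S.u i j * (∑ l, 2 * S.k * S.w l * S.u j l ^ 2) * z else 0) := by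
    have h0 : S.D i (2 * S.k * S.w j) = 0 := by
      have h2 : S.D i (2 : K) = 0 := by exact_mod_cast (S.D i).map_natCast 2
      simp [S.D_k, S.D_w, h2]
    intro a
    simp only [L_apply, M_apply]
    by_cases hj : a = j
    · subst hj
      simp only [hij, hij.symm, if_true, if_false, u_self]
      ring
    · by_cases hi : a = i
      · subst hi
        simp only [hij, if_true, if_false, u_self, sub_zero, Derivation.leibniz _ _ z,
          Derivation.leibniz _ _ (S.u a j ^ 2), D_u_sq, h0, smul_eq_mul]
        ring
      · simp only [hi, hj, Ne.symm hi, if_false]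
        ring
  have hs := S.sum_w_mul_u hij
  simp only [mul_add, Finset.sum_add_distrib] at hs
  have hr : ∑ a, S.w a * (S.u i j * (S.u i a ^ 2 - S.u j a ^ 2)) * (2 * S.k) =
      S.u i j * (∑ l, 2 * S.k * S.w l * S.u i l ^ 2)
      - S.u i j * (∑ l, 2 * S.k * S.w l * S.u j l ^ 2) := by
    rw [Finset.mul_sum, Finset.mul_sum, ← Finset.sum_sub_distrib]
    exact Finset.sum_congr rfl fun a _ => by ring
  rw [← Finset.sum_mul] at hr
  simp only [h, Finset.sum_add_distrib, Finset.sum_sub_distrib, Finset.sum_ite_eq',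
    Finset.mem_univ, if_true, ← Finset.mul_sum, ← Finset.sum_mul]
  simp only [L_apply, hij, if_false, zero_add, S.H_mul_u hij]
  have hc : S.k * S.w j - S.k * S.w i = (S.w i)⁻¹ - (S.w j)⁻¹ := by
    linear_combination S.add_eq j - S.add_eq i
  linear_combination (-2 * S.k ^ 2 * S.w j * z) * hs + S.k * S.w j * z * hr
    - 2 * S.k * S.w j * S.u i j ^ 3 * z * hc

lemma lax : S.L * Matrix.diagonal (fun _ => S.H) - Matrix.diagonal (fun _ => S.H) * S.L =
    S.L * S.M - S.M * S.L := by
  refine Matrix.ext fun i j => LinearMap.ext fun z => ?_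
  simp only [Matrix.sub_apply, Matrix.mul_diagonal, Matrix.diagonal_mul]
  simp only [Matrix.mul_apply, LinearMap.sub_apply, Module.End.mul_apply, LinearMap.sum_apply]
  rw [← Finset.sum_sub_distrib]
  by_cases hij : i = j
  · subst hij
    exact S.lax_diag i z
  · exact S.lax_off_diag hij z

lemma lax_pow (r : ℕ) :
    S.L ^ r * Matrix.diagonal (fun _ => S.H) - Matrix.diagonal (fun _ => S.H) * S.L ^ r =
      S.L ^ r * S.M - S.M * S.L ^ r := by
  have h : Commute S.L (Matrix.diagonal (fun _ => S.H) - S.M) := by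
    rw [commute_iff_eq, mul_sub, sub_mul, ← sub_eq_sub_iff_sub_eq_sub]
    exact S.lax
  have hr := (h.pow_left r).eq
  rw [mul_sub, sub_mul] at hr
  rw [sub_eq_sub_iff_sub_eq_sub]
  exact hr

lemma sum_M (i : ι) (z : K) : ∑ j, S.M i j z = 0 := by
  simp only [M_apply, ← Finset.sum_mul, Finset.sum_sub_distrib, Finset.sum_ite_eq,
    Finset.mem_univ, if_true, sub_self, zero_mul]

lemma sum_w_mul_M (j : ι) (z : K) : ∑ i, S.w i * S.M i j z = 0 := by
  have h : ∀ i, S.w i * S.M i j z = S.w j * (2 * S.k * S.w i * S.u j i ^ 2) * z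
      - if i = j then S.w j * (∑ l, 2 * S.k * S.w l * S.u j l ^ 2) * z else 0 := by
    intro i
    rw [M_apply, S.u_swap j i]
    split_ifs with hij
    · subst hij
      ring
    · ring
  simp only [h, ← Finset.sum_mul, ← Finset.mul_sum, Finset.sum_sub_distrib, Finset.sum_ite_eq',
    Finset.mem_univ, if_true, sub_self]

/-- The deformed total traces of the powers of the quantum Moser matrix commute with `H`. -/
theorem total_trace_comm (r : ℕ) (z : K) :
    ∑ i, ∑ j, S.w i * (S.L ^ r) i j (S.H z) = S.H (∑ i, ∑ j, S.w i * (S.L ^ r) i j z) := by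
  have h : ∀ i j, (S.L ^ r) i j (S.H z) - S.H ((S.L ^ r) i j z) =
      ∑ a, (S.L ^ r) i a (S.M a j z) - ∑ a, S.M i a ((S.L ^ r) a j z) := by
    intro i j
    have := LinearMap.congr_fun (congrFun (congrFun (S.lax_pow r) i) j) z
    simp only [Matrix.sub_apply, Matrix.mul_diagonal, Matrix.diagonal_mul] at this
    simpa only [Matrix.mul_apply, LinearMap.sub_apply, Module.End.mul_apply,
      LinearMap.sum_apply] using this
  have h1 : ∑ i, ∑ j, S.w i * ∑ a, (S.L ^ r) i a (S.M a j z) = 0 := by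
    refine Finset.sum_eq_zero fun i _ => ?_
    rw [← Finset.mul_sum, Finset.sum_comm]
    simp only [← map_sum, S.sum_M, map_zero, Finset.sum_const_zero, mul_zero]
  have h2 : ∑ i, ∑ j, S.w i * ∑ a, S.M i a ((S.L ^ r) a j z) = 0 := by
    rw [Finset.sum_comm]
    refine Finset.sum_eq_zero fun j _ => ?_
    simp only [Finset.mul_sum]
    rw [Finset.sum_comm]
    simp only [S.sum_w_mul_M, Finset.sum_const_zero]
  simp only [map_sum, S.H_mul_of_const (fun a => S.D_w a _)]
  rw [← sub_eq_zero, ← Finset.sum_sub_distrib]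
  simp only [← Finset.sum_sub_distrib, ← mul_sub, h]
  simp only [mul_sub, Finset.sum_sub_distrib, h1, h2, sub_self]

end Data
end Abstract

section Derivation

variable {K : Type*} [Field K]

/-- An additive map satisfying the Leibniz rule is a derivation. -/
def derivationOfLeibniz (f : K → K) (hadd : ∀ y z, f (y + z) = f y + f z)
    (hmul : ∀ y z, f (y * z) = y * f z + z * f y) : Derivation ℤ K K :=
  Derivation.mk' (AddMonoidHom.mk' f hadd).toIntLinearMap hmul

lemma derivation_comm_of_mul_eq {D₁ D₂ : Derivation ℤ K K} {z p q : K} (hq : q ≠ 0)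
    (h : z * q = p) (hDp : D₁ (D₂ p) = D₂ (D₁ p)) (hDq : D₁ (D₂ q) = D₂ (D₁ q)) :
    D₁ (D₂ z) = D₂ (D₁ z) := by
  have hz := congrArg (⁅D₁, D₂⁆ : Derivation ℤ K K) h
  rw [Derivation.leibniz, Derivation.commutator_apply, Derivation.commutator_apply,
    Derivation.commutator_apply, hDp, hDq, sub_self, sub_self, smul_zero, zero_add,
    smul_eq_mul] at hz
  exact sub_eq_zero.1 ((mul_eq_zero.1 hz).resolve_left hq)

lemma derivation_zpow_eq_zero {D : Derivation ℤ K K} {c : K} (hc : D c = 0) (e : ℤ) :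
    D (c ^ e) = 0 := by
  rw [Derivation.leibniz_zpow, hc, smul_zero, smul_zero]

end Derivation

section Concrete

variable {n m : ℕ}

lemma emb_add (p q : PR n m) : emb n m (p + q) = emb n m p + emb n m q := map_add _ p q

lemma emb_mul (p q : PR n m) : emb n m (p * q) = emb n m p * emb n m q := map_mul _ p q

lemma emb_inj {p q : PR n m} (h : emb n m p = emb n m q) : p = q :=
  IsFractionRing.injective (PR n m) (F n m) h

lemma emb_ne {p : PR n m} (h : p ≠ 0) : emb n m p ≠ 0 := fun h0 =>
  h (emb_inj (h0.trans (map_zero (algebraMap (PR n m) (F n m))).symm))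

lemma den_ne (z : F n m) : den n m z ≠ 0 :=
  nonZeroDivisors.ne_zero (IsLocalization.sec (nonZeroDivisors (PR n m)) z).2.2

lemma mul_den (z : F n m) : z * emb n m (den n m z) = emb n m (num n m z) :=
  IsLocalization.sec_spec (nonZeroDivisors (PR n m)) z

/-- The quotient rule for `fder` holds for every representation as a fraction. -/
lemma fder_eq (i : Fin (n + m)) {z : F n m} {p q : PR n m} (hq : q ≠ 0)
    (h : z * emb n m q = emb n m p) :
    fder n m i z = (emb n m (pderiv i p) * emb n m q - emb n m p * emb n m (pderiv i q))
      / emb n m q ^ 2 := by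
  have hB := emb_ne (den_ne z)
  have hq' := emb_ne hq
  have h1 : num n m z * q = p * den n m z := by
    apply emb_inj
    rw [emb_mul, emb_mul, ← mul_den, ← h]
    ring
  have h2 := congrArg (pderiv i) h1
  simp only [Derivation.leibniz, smul_eq_mul] at h2
  have e1 := congrArg (emb n m) h1
  have e2 := congrArg (emb n m) h2
  simp only [emb_mul, emb_add] at e1 e2
  rw [fder, div_eq_div_iff (pow_ne_zero 2 hB) (pow_ne_zero 2 hq')]
  linear_combination emb n m (den n m z) * emb n m q * e2
    - (emb n m (den n m z) * emb n m (pderiv i q) + emb n m q * emb n m (pderiv i (den n m z))) * e1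

lemma fder_emb (i : Fin (n + m)) (p : PR n m) : fder n m i (emb n m p) = emb n m (pderiv i p) := by
  have h1 : emb n m 1 = 1 := map_one (algebraMap (PR n m) (F n m))
  have h0 : emb n m 0 = 0 := map_zero (algebraMap (PR n m) (F n m))
  rw [fder_eq i (p := p) one_ne_zero (by rw [h1, mul_one])]
  simp [h1, h0]

lemma fder_add (i : Fin (n + m)) (y z : F n m) :
    fder n m i (y + z) = fder n m i y + fder n m i z := by
  have hy := emb_ne (den_ne y)
  have hz := emb_ne (den_ne z)
  rw [fder_eq i (p := num n m y * den n m z + num n m z * den n m y)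
    (mul_ne_zero (den_ne y) (den_ne z)), fder, fder]
  · simp only [Derivation.leibniz, smul_eq_mul, map_add, emb_mul, emb_add]
    field_simp
    ring
  · simp only [emb_mul, emb_add, ← mul_den]
    ring

lemma fder_mul (i : Fin (n + m)) (y z : F n m) :
    fder n m i (y * z) = y * fder n m i z + z * fder n m i y := by
  have hy := emb_ne (den_ne y)
  have hz := emb_ne (den_ne z)
  rw [fder_eq i (p := num n m y * num n m z) (mul_ne_zero (den_ne y) (den_ne z)), fder, fder]
  · simp only [Derivation.leibniz, smul_eq_mul, emb_mul, emb_add, ← mul_den]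
    field_simp
    ring
  · simp only [emb_mul, ← mul_den]
    ring

/-- The partial derivative on rational functions as a derivation. -/
noncomputable def der (n m : ℕ) (i : Fin (n + m)) :=
  derivationOfLeibniz (K := F n m) (fder n m i) (fder_add i) (fder_mul i)

lemma der_apply (i : Fin (n + m)) (z : F n m) : der n m i z = fder n m i z := rfl

lemma pderiv_comm (i j : Fin (n + m)) (p : PR n m) :
    pderiv i (pderiv j p) = pderiv j (pderiv i p) := by
  have h : ⁅(pderiv i : Derivation ℂ (PR n m) (PR n m)),
      (pderiv j : Derivation ℂ (PR n m) (PR n m))⁆ = 0 := by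
    refine MvPolynomial.derivation_ext fun l => ?_
    simp [Derivation.commutator_apply, pderiv_X, Pi.single_apply, apply_ite]
  have := congrArg (fun d : Derivation ℂ (PR n m) (PR n m) => d p) h
  simpa [Derivation.commutator_apply, sub_eq_zero] using this

lemma der_comm (i j : Fin (n + m)) (z : F n m) :
    der n m i (der n m j z) = der n m j (der n m i z) :=
  derivation_comm_of_mul_eq (emb_ne (den_ne z)) (mul_den z)
    (by simp only [der_apply, fder_emb, pderiv_comm i j])
    (by simp only [der_apply, fder_emb, pderiv_comm i j])

lemma der_cc (i : Fin (n + m)) (c : ℂ) : der n m i (cc n m c) = 0 := by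
  rw [der_apply, cc, fder_emb, pderiv_C]
  exact map_zero (algebraMap (PR n m) (F n m))

lemma cc_ne {k : ℂ} (hk : k ≠ 0) : cc n m k ≠ 0 :=
  emb_ne (by simpa using hk)

/-- The deformed rational CMS system on the field of rational functions. -/
noncomputable def system (n m : ℕ) (k : ℂ) (hk : k ≠ 0) : Data (Fin (n + m)) (F n m) where
  D := der n m
  x := xi n m
  k := cc n m k
  w i := cc n m k ^ (-pE n m i)
  comm := der_comm
  D_x i j := by
    rw [der_apply, xi, fder_emb]
    split_ifs with hij
    · rw [hij, pderiv_X_self]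
      exact map_one (algebraMap (PR n m) (F n m))
    · rw [pderiv_X_of_ne (Ne.symm hij)]
      exact map_zero (algebraMap (PR n m) (F n m))
  x_ne i j hij h := hij (MvPolynomial.X_injective (emb_inj (sub_eq_zero.1 h)))
  w_ne i := zpow_ne_zero _ (cc_ne hk)
  D_k i := der_cc i k
  D_w i j := derivation_zpow_eq_zero (der_cc i k) _
  add_eq i := by
    have := cc_ne (n := n) (m := m) hk
    rw [pE]
    split_ifs
    · simp
    · simp [this, add_comm]

lemma sum_sum_eq_sum_lt {ι M : Type*} [Fintype ι] [LinearOrder ι] [AddCommMonoid M]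
    (f : ι → ι → M) (h0 : ∀ i, f i i = 0) (hs : ∀ i j, f i j = f j i) :
    ∑ i, ∑ j, f i j = ∑ i, ∑ j, if i < j then 2 • f i j else 0 := by
  have h : ∀ i j, f i j = (if i < j then f i j else 0) + if j < i then f j i else 0 := by
    intro i j
    rcases lt_trichotomy i j with hij | rfl | hij
    · simp [hij, hij.not_gt]
    · simp [h0]
    · simp [hij, hij.not_gt, hs i j]
  calc ∑ i, ∑ j, f i j
      = ∑ i, ∑ j, ((if i < j then f i j else 0) + if j < i then f j i else 0) :=
        Finset.sum_congr rfl fun i _ => Finset.sum_congr rfl fun j _ => h i j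
    _ = ∑ i, ∑ j, if i < j then 2 • f i j else 0 := by
        simp only [Finset.sum_add_distrib]
        rw [Finset.sum_comm (f := fun i j => if j < i then f j i else 0)]
        simp only [← Finset.sum_add_distrib]
        refine Finset.sum_congr rfl fun i _ => Finset.sum_congr rfl fun j _ => ?_
        split_ifs <;> simp [two_nsmul]

variable {k : ℂ} (hk : k ≠ 0)

lemma L_system (i j : Fin (n + m)) (z : F n m) : (system n m k hk).L i j z = Lmat n m k i j z := by
  have hc := cc_ne (n := n) (m := m) hk
  rw [Data.L_apply, Lmat]
  by_cases hij : i = j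
  · subst hij
    simp [Data.u_self, system, der_apply]
  · simp only [hij, if_false, zero_add, Data.u, system]
    rw [sub_eq_add_neg 1, zpow_add₀ hc, zpow_one]

lemma L_pow_system (r : ℕ) (i j : Fin (n + m)) (z : F n m) :
    ((system n m k hk).L ^ r) i j z = mpow (Lmat n m k) r i j z := by
  induction r generalizing i j with
  | zero => by_cases hij : i = j <;> simp [mpow, hij]
  | succ r ih =>
    rw [pow_succ', Matrix.mul_apply, LinearMap.sum_apply, mpow, mmul]
    exact Finset.sum_congr rfl fun a _ => by rw [Module.End.mul_apply, L_system, ih]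

lemma W_system : (system n m k hk).W =
    -(∑ i : Fin (n + m), ∑ j : Fin (n + m),
        if (i : ℕ) < (j : ℕ) ∧ (j : ℕ) < n then
          2 * cc n m k * (cc n m k + 1) * ((xi n m i - xi n m j) ^ 2)⁻¹ else 0)
    - (∑ i : Fin (n + m), ∑ j : Fin (n + m),
        if n ≤ (i : ℕ) ∧ (i : ℕ) < (j : ℕ) then
          2 * ((cc n m k)⁻¹ + 1) * ((xi n m i - xi n m j) ^ 2)⁻¹ else 0)
    - ∑ i : Fin (n + m), ∑ j : Fin (n + m),
        if (i : ℕ) < n ∧ n ≤ (j : ℕ) then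
          2 * (cc n m k + 1) * ((xi n m i - xi n m j) ^ 2)⁻¹ else 0 := by
  have hc := cc_ne (n := n) (m := m) hk
  rw [Data.W, sum_sum_eq_sum_lt _ (fun i => by simp [Data.u_self])
    (fun i j => by rw [Data.u_swap _ j i]; ring), ← neg_add', ← neg_add',
    ← Finset.sum_add_distrib, ← Finset.sum_add_distrib]
  simp only [← Finset.sum_add_distrib]
  refine congrArg _ (Finset.sum_congr rfl fun i _ => Finset.sum_congr rfl fun j _ => ?_)
  simp only [Data.u, system, pE, Fin.lt_def, nsmul_eq_mul, Nat.cast_ofNat, inv_pow]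
  by_cases hij : (i : ℕ) < j
  · by_cases hi : (i : ℕ) < n <;> by_cases hj : (j : ℕ) < n
    · simp [hi, hj, hij, not_le.2 hi, not_le.2 hj]
      ring
    · simp [hi, hj, hij, not_lt.1 hj, not_le.2 hi]
      field_simp
    · omega
    · simp [hi, hj, hij, not_lt.1 hi, not_lt.1 hj]
      field_simp
      ring
  · have h1 : ¬((i : ℕ) < n ∧ n ≤ (j : ℕ)) := by omega
    simp [hij, h1]

lemma H_system (z : F n m) : (system n m k hk).H z = Hnm n m k z := by
  rw [Data.H_apply, W_system, Hnm, ← Finset.sum_filter_add_sum_filter_not Finset.univ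
    (fun i : Fin (n + m) => (i : ℕ) < n), Finset.mul_sum]
  have h1 : ∑ i ∈ Finset.univ.filter (fun i : Fin (n + m) => (i : ℕ) < n),
      ((system n m k hk).w i)⁻¹ * (system n m k hk).D i ((system n m k hk).D i z) =
      ∑ i ∈ Finset.univ.filter (fun i : Fin (n + m) => (i : ℕ) < n),
        fder n m i (fder n m i z) := by
    refine Finset.sum_congr rfl fun i hi => ?_
    simp [system, der_apply, pE, (Finset.mem_filter.1 hi).2]
  have h2 : ∑ i ∈ Finset.univ.filter (fun i : Fin (n + m) => ¬ (i : ℕ) < n),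
      ((system n m k hk).w i)⁻¹ * (system n m k hk).D i ((system n m k hk).D i z) =
      ∑ i ∈ Finset.univ.filter (fun i : Fin (n + m) => n ≤ (i : ℕ)),
        cc n m k * fder n m i (fder n m i z) := by
    simp only [not_lt]
    refine Finset.sum_congr rfl fun i hi => ?_
    simp [system, der_apply, pE, not_lt.2 (Finset.mem_filter.1 hi).2]
  rw [h1, h2]
  ring

end Concrete

end DeformedCMS

/-- for every r ≥ 1, the deformed total trace L^{(r)}_{n,m} of the r-th
power of the quantum Moser matrix commutes with the deformed rational CMS operator:
[L^{(r)}_{n,m}, H_{n,m}] = 0 in End_ℂ(F). -/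
theorem deformed_trace_powers_commute_with_H (n m : ℕ) (k : ℂ) (hk : k ≠ 0)
    (r : ℕ) (hr : 1 ≤ r) (z : F n m) :
    Lop n m k r (Hnm n m k z) = Hnm n m k (Lop n m k r z) := by
  have h := (DeformedCMS.system n m k hk).total_trace_comm r z
  simp only [DeformedCMS.L_pow_system, DeformedCMS.H_system] at h
  exact h
end

section
/- For every r ≥ 1, the operator L^{(r)}_{n,m} = Σ_{i,j=1}^{n+m} k^{−p(i)}·(L^r)_{ij} = e*·L^r·e, built from the trigonometric quantum Moser matrix, commutes with the deformed trigonometric CMS operator: [L^{(r)}_{n,m}, H_{n,m}] = 0 in End_ℂ(F); moreover these operators commute with each other: [L^{(r)}_{n,m}, L^{(s)}_{n,m}] = 0 for all r, s ≥ 1. -/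
open Polynomial MvPolynomial

noncomputable section
variable (n m : ℕ) (k : ℂ)

/-- the trigonometric quantum Moser matrix L: L_{ii} = k^{p(i)} x_i ∂/∂x_i, and for
i ≠ j, L_{ij} = multiplication by (1/2) k^{1−p(j)} (x_i + x_j)/(x_i − x_j). -/
def LmatT (i j : Fin (n + m)) : F n m → F n m :=
  if i = j then fun z => (cc n m k) ^ (pE n m i) * (xi n m i * fder n m i z)
  else fun z => (1 / 2) * (cc n m k) ^ (1 - pE n m j)
    * ((xi n m i + xi n m j) * (xi n m i - xi n m j)⁻¹) * z

/-- the matrix M: for i ≠ j, M_{ij} = multiplication by 2k^{1−p(j)} x_i x_j/(x_i−x_j)²,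
and M_{ii} = −Σ_{j≠i} multiplication by 2k^{1−p(j)} x_i x_j/(x_i−x_j)². -/
def MmatT (i j : Fin (n + m)) : F n m → F n m :=
  if i = j then
    fun z => -(∑ l ∈ Finset.univ.erase i,
        2 * (cc n m k) ^ (1 - pE n m l) * (xi n m i * xi n m l)
          * ((xi n m i - xi n m l) ^ 2)⁻¹) * z
  else fun z => 2 * (cc n m k) ^ (1 - pE n m j) * (xi n m i * xi n m j)
    * ((xi n m i - xi n m j) ^ 2)⁻¹ * z

/-- the deformed trigonometric CMS operator H_{n,m} in exponential coordinates
(potential terms acting by multiplication). -/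
def HnmT (z : F n m) : F n m :=
  (∑ i ∈ Finset.univ.filter (fun i : Fin (n + m) => (i : ℕ) < n),
      xi n m i * fder n m i (xi n m i * fder n m i z))
  + cc n m k * (∑ j ∈ Finset.univ.filter (fun j : Fin (n + m) => n ≤ (j : ℕ)),
      xi n m j * fder n m j (xi n m j * fder n m j z))
  - (∑ i : Fin (n + m), ∑ j : Fin (n + m),
      if (i : ℕ) < (j : ℕ) ∧ (j : ℕ) < n then
        2 * cc n m k * (cc n m k + 1) * (xi n m i * xi n m j)
          * ((xi n m i - xi n m j) ^ 2)⁻¹ else 0) * z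
  - (∑ i : Fin (n + m), ∑ j : Fin (n + m),
      if n ≤ (i : ℕ) ∧ (i : ℕ) < (j : ℕ) then
        2 * ((cc n m k)⁻¹ + 1) * (xi n m i * xi n m j)
          * ((xi n m i - xi n m j) ^ 2)⁻¹ else 0) * z
  - (∑ i : Fin (n + m), ∑ j : Fin (n + m),
      if (i : ℕ) < n ∧ n ≤ (j : ℕ) then
        2 * (cc n m k + 1) * (xi n m i * xi n m j)
          * ((xi n m i - xi n m j) ^ 2)⁻¹ else 0) * z

end

noncomputable section

/-- L^{(r)}_{n,m} = Σ_{i,j} k^{−p(i)} (L^r)_{ij} = e*·L^r·e, built from the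
trigonometric quantum Moser matrix. -/
def LopT (n m : ℕ) (k : ℂ) (r : ℕ) (z : F n m) : F n m :=
  ∑ i : Fin (n + m), ∑ j : Fin (n + m),
    (cc n m k) ^ (-(pE n m i)) * mpow (LmatT n m k) r i j z

end

noncomputable section

/-- A trigonometric Moser system: operators `D i` acting on functions through the commuting
derivations `δ i`, with pair functions `a i j` obeying the trigonometric functional equations and
masses `κ i` in `{1, k}`. -/
structure MoserSystem (ι A E : Type*) [CommRing A] [Algebra ℂ A] [Ring E] [Algebra ℂ E] where
  k : ℂ
  κ : ι → ℂ
  μ : A →ₐ[ℂ] E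
  δ : ι → Derivation ℂ A A
  D : ι → E
  a : ι → ι → A
  k_ne_zero : k ≠ 0
  κ_eq : ∀ i, κ i = 1 ∨ κ i = k
  D_mul_μ : ∀ i f, D i * μ f = μ f * D i + μ (δ i f)
  D_comm : ∀ i j, D i * D j = D j * D i
  a_swap : ∀ i j, a j i = -a i j
  δ_a : ∀ i j, i ≠ j → δ i (a i j) = algebraMap ℂ A (1 / 4) - a i j ^ 2
  δ_a_of_ne : ∀ l i j, l ≠ i → l ≠ j → δ l (a i j) = 0
  a_cyclic : ∀ i j l, i ≠ j → j ≠ l → l ≠ i →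
    a i j * a j l + a j l * a l i + a l i * a i j = -algebraMap ℂ A (1 / 4)

namespace MoserSystem

open Finset

variable {ι A E : Type*} [CommRing A] [Algebra ℂ A] [Ring E] [Algebra ℂ E]
  (S : MoserSystem ι A E)

lemma κ_ne_zero (i : ι) : S.κ i ≠ 0 := by
  rcases S.κ_eq i with h | h <;> rw [h]
  · exact one_ne_zero
  · exact S.k_ne_zero

/-- The pair potential. -/
def b (i j : ι) : A := S.a i j ^ 2 - algebraMap ℂ A (1 / 4)

lemma b_swap (i j : ι) : S.b j i = S.b i j := by
  simp [b, S.a_swap i j]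

lemma δ_left_a {i j : ι} (h : i ≠ j) : S.δ i (S.a i j) = -S.b i j := by
  rw [S.δ_a i j h, b]; ring

lemma δ_right_a {i j : ι} (h : i ≠ j) : S.δ j (S.a i j) = S.b i j := by
  rw [S.a_swap j i, map_neg, S.δ_left_a h.symm, b_swap, neg_neg]

lemma δ_b (l i j : ι) : S.δ l (S.b i j) = 2 * S.a i j * S.δ l (S.a i j) := by
  simp [b, Derivation.leibniz_pow, mul_assoc]

lemma δ_b_of_ne {l i j : ι} (hi : l ≠ i) (hj : l ≠ j) : S.δ l (S.b i j) = 0 := by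
  rw [δ_b, S.δ_a_of_ne l i j hi hj, mul_zero]

lemma three_body {i j l : ι} (hij : i ≠ j) (hjl : j ≠ l) (hli : l ≠ i) :
    S.a i j * (S.b i l - S.b j l) + (S.a i l * S.b l j - S.b i l * S.a l j) = 0 := by
  have h := S.a_cyclic i j l hij hjl hli
  have h1 := S.a_swap i l
  have h2 := S.a_swap j l
  simp only [b, h1, h2] at h ⊢
  generalize algebraMap ℂ A (1 / 4) = q at *
  linear_combination -(S.a i l + S.a j l) * h

variable [LinearOrder ι]

/-- The Moser matrix. -/
def lax : Matrix ι ι E := fun i j =>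
  if i = j then S.κ i • S.D i else S.μ ((S.k / S.κ j) • S.a i j)

lemma lax_diag (i : ι) : S.lax i i = S.κ i • S.D i := if_pos rfl

lemma lax_off {i j : ι} (h : i ≠ j) : S.lax i j = S.μ ((S.k / S.κ j) • S.a i j) := if_neg h

variable [Fintype ι]

/-- The second matrix of the Lax pair. -/
def aux : Matrix ι ι A := fun i j =>
  if i = j then -∑ l ∈ univ.erase i, (2 * S.k / S.κ l) • S.b i l
  else (2 * S.k / S.κ j) • S.b i j

/-- The coupling between two particles. -/
def coupling (i j : ι) : ℂ := 2 * S.k * (S.k + 1) / (S.κ i * S.κ j)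

/-- The potential. -/
def pot : A := ∑ i, ∑ j, if i < j then S.coupling i j • S.b i j else 0

/-- The Hamiltonian. -/
def ham : E := ∑ i, S.κ i • (S.D i * S.D i) - S.μ S.pot

lemma μ_mul_ham_sub (f : A) :
    S.μ f * S.ham - S.ham * S.μ f =
      -∑ l, S.κ l • ((2 : ℂ) • (S.μ (S.δ l f) * S.D l) + S.μ (S.δ l (S.δ l f))) := by
  have h : ∀ l, S.D l * S.D l * S.μ f = S.μ f * (S.D l * S.D l) +
      ((2 : ℂ) • (S.μ (S.δ l f) * S.D l) + S.μ (S.δ l (S.δ l f))) := fun l => by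
    rw [mul_assoc, S.D_mul_μ, mul_add, ← mul_assoc, S.D_mul_μ, S.D_mul_μ, two_smul]
    noncomm_ring
  have hp : S.μ f * S.μ S.pot = S.μ S.pot * S.μ f := by rw [← map_mul, mul_comm, map_mul]
  simp only [ham, mul_sub, sub_mul, mul_sum, sum_mul, hp, smul_mul_assoc, mul_smul_comm, h,
    smul_add, sum_add_distrib]
  abel

lemma δ_pot (l : ι) : S.δ l S.pot =
    -∑ j ∈ univ.erase l, (2 * S.coupling l j) • (S.a l j * S.b l j) := by
  have hl : ∀ j, j ≠ l → S.δ l (S.b l j) = -(2 : ℂ) • (S.a l j * S.b l j) := fun j hj => by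
    rw [δ_b, S.δ_left_a hj.symm, neg_smul, two_smul]; ring
  have key : ∀ i j, S.δ l (if i < j then S.coupling i j • S.b i j else 0) =
      (if i = l then if l < j then S.coupling l j • S.δ l (S.b l j) else 0 else 0) +
      (if j = l then if i < l then S.coupling l i • S.δ l (S.b l i) else 0 else 0) := by
    intro i j
    by_cases hij : i < j
    · rw [if_pos hij]
      by_cases hi : i = l
      · subst hi; simp [hij, hij.ne']
      · by_cases hj : j = l
        · subst hj; simp [hij, hij.ne, S.b_swap i j, coupling, mul_comm]
        · simp [hi, hj, S.δ_b_of_ne (Ne.symm hi) (Ne.symm hj)]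
    · rw [if_neg hij, map_zero]
      by_cases hi : i = l
      · subst hi
        simp only [hij, if_true, if_false]
        split_ifs <;> simp_all
      · by_cases hj : j = l
        · subst hj; simp [hij, hi]
        · simp [hi, hj]
  simp only [pot, map_sum, key, sum_add_distrib]
  simp only [sum_ite_irrel, sum_const_zero, sum_ite_eq', mem_univ, if_true]
  rw [← sum_add_distrib, ← sum_neg_distrib, ← sum_subset (erase_subset l univ)]
  · refine sum_congr rfl fun j hj => ?_
    have hj := ne_of_mem_erase hj
    rw [hl j hj]
    rcases lt_or_gt_of_ne hj with h | h
    · rw [if_neg h.not_gt, if_pos h, zero_add]; module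
    · rw [if_neg h.not_gt, if_pos h, add_zero]; module
  · intro j _ hj
    have : j = l := by simpa using hj
    simp [this]

lemma aux_diag (i : ι) : S.aux i i = -∑ l ∈ univ.erase i, (2 * S.k / S.κ l) • S.b i l := if_pos rfl

lemma aux_off {i j : ι} (h : i ≠ j) : S.aux i j = (2 * S.k / S.κ j) • S.b i j := if_neg h

lemma lax_diag_ham (i : ι) : S.lax i i * S.ham - S.ham * S.lax i i =
    ∑ l, (S.lax i l * S.μ (S.aux l i) - S.μ (S.aux i l) * S.lax l i) := by
  have h1 : S.lax i i * S.ham - S.ham * S.lax i i = -(S.μ (S.κ i • S.δ i S.pot)) := by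
    have : ∀ l, S.D i * (S.D l * S.D l) = S.D l * S.D l * S.D i := fun l => by
      rw [← mul_assoc, S.D_comm i l, mul_assoc, S.D_comm i l, mul_assoc]
    simp only [lax_diag, ham, mul_sub, sub_mul, mul_sum, sum_mul, mul_smul_comm, smul_mul_assoc,
      this, S.D_mul_μ, map_smul, smul_add, smul_sub, smul_sum, smul_comm (S.κ i)]
    abel
  have h2 : S.lax i i * S.μ (S.aux i i) - S.μ (S.aux i i) * S.lax i i =
      S.μ (S.κ i • S.δ i (S.aux i i)) := by
    simp only [lax_diag, smul_mul_assoc, mul_smul_comm, S.D_mul_μ, map_smul, smul_add]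
    abel
  have h3 : ∀ l ∈ univ.erase i, S.lax i l * S.μ (S.aux l i) - S.μ (S.aux i l) * S.lax l i =
      S.μ ((4 * S.k ^ 2 / (S.κ i * S.κ l)) • (S.a i l * S.b i l)) := fun l hl => by
    have hl := ne_of_mem_erase hl
    rw [S.lax_off hl.symm, S.lax_off hl, S.aux_off hl, S.aux_off hl.symm, ← map_mul, ← map_mul,
      ← map_sub, S.a_swap i l, S.b_swap i l]
    congr 1
    simp only [smul_mul_smul_comm, mul_neg, smul_neg, mul_comm (S.b i l), sub_neg_eq_add,
      ← add_smul]
    congr 1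
    field_simp [S.κ_ne_zero]
    ring
  rw [h1, ← add_sum_erase univ _ (mem_univ i), sum_congr rfl h3, h2, ← map_sum, ← map_add,
    ← map_neg]
  congr 1
  rw [δ_pot, aux_diag, map_neg, map_sum, smul_neg, smul_neg, neg_neg, smul_sum, smul_sum,
    ← sub_eq_zero, sub_add_eq_sub_sub, sub_neg_eq_add, ← sum_add_distrib, ← sum_sub_distrib]
  refine sum_eq_zero fun l hl => ?_
  have hl := ne_of_mem_erase hl
  have : S.δ i (S.b i l) = -(2 : ℂ) • (S.a i l * S.b i l) := by
    rw [δ_b, S.δ_left_a hl.symm, neg_smul, two_smul]; ring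
  rw [Derivation.map_smul, this]
  simp only [smul_smul, ← add_smul, ← sub_smul]
  convert zero_smul ℂ _
  have hk := S.k_ne_zero
  have hκ := S.κ_ne_zero l
  unfold coupling
  rcases S.κ_eq i with h | h <;> rw [h] <;> field_simp <;> ring

lemma lax_off_ham {i j : ι} (hij : i ≠ j) : S.lax i j * S.ham - S.ham * S.lax i j =
    ∑ l, (S.lax i l * S.μ (S.aux l j) - S.μ (S.aux i l) * S.lax l j) := by
  set T := (univ.erase i).erase j with hT
  have hsplit : ∀ {B : Type _} [AddCommGroup B] (g : ι → B),
      ∑ l, g l = g i + (g j + ∑ l ∈ T, g l) :=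
    fun g => by
      rw [← add_sum_erase univ g (mem_univ i), ← add_sum_erase (univ.erase i) g (a := j)]
      simp [hij.symm]
  have hi : ∑ l ∈ univ.erase i, (2 * S.k / S.κ l) • S.b i l =
      (2 * S.k / S.κ j) • S.b i j + ∑ l ∈ T, (2 * S.k / S.κ l) • S.b i l := by
    rw [hT, add_sum_erase (univ.erase i) (fun l => (2 * S.k / S.κ l) • S.b i l)]; simp [hij.symm]
  have hj : ∑ l ∈ univ.erase j, (2 * S.k / S.κ l) • S.b j l =
      (2 * S.k / S.κ i) • S.b i j + ∑ l ∈ T, (2 * S.k / S.κ l) • S.b j l := by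
    rw [hT, erase_right_comm, ← S.b_swap i j,
      add_sum_erase (univ.erase j) (fun l => (2 * S.k / S.κ l) • S.b j l)]; simp [hij]
  have hmem : ∀ l ∈ T, l ≠ i ∧ l ≠ j := fun l hl => by
    rw [hT] at hl; simp at hl; tauto
  have h1 : S.lax i j * S.ham - S.ham * S.lax i j =
      -((S.k / S.κ j) • (S.κ i • (-(2 : ℂ) • (S.μ (S.b i j) * S.D i) +
          (2 : ℂ) • S.μ (S.a i j * S.b i j)) +
        S.κ j • ((2 : ℂ) • (S.μ (S.b i j) * S.D j) + (2 : ℂ) • S.μ (S.a i j * S.b i j)))) := by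
    have h0 : ∀ l ∈ T, S.κ l • ((2 : ℂ) • (S.μ (S.δ l (S.a i j)) * S.D l) +
        S.μ (S.δ l (S.δ l (S.a i j)))) = 0 := fun l hl => by
      rw [S.δ_a_of_ne l i j (hmem l hl).1 (hmem l hl).2]; simp
    rw [S.lax_off hij, map_smul, smul_mul_assoc, mul_smul_comm, ← smul_sub, μ_mul_ham_sub, hsplit,
      sum_eq_zero h0, S.δ_left_a hij, S.δ_right_a hij, map_neg (S.δ i), δ_b, δ_b, S.δ_left_a hij,
      S.δ_right_a hij]
    have e : S.μ (-(2 * S.a i j * -S.b i j)) = (2 : ℂ) • S.μ (S.a i j * S.b i j) := by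
      rw [← map_smul, two_smul]; congr 1; ring
    have e' : S.μ (2 * S.a i j * S.b i j) = (2 : ℂ) • S.μ (S.a i j * S.b i j) := by
      rw [← map_smul, two_smul]; congr 1; ring
    rw [e, e', map_neg, neg_mul]
    module
  have hT' : ∀ l ∈ T, S.lax i l * S.μ (S.aux l j) - S.μ (S.aux i l) * S.lax l j =
      S.μ ((S.k / S.κ j) • (S.a i j *
        ((2 * S.k / S.κ l) • S.b j l - (2 * S.k / S.κ l) • S.b i l))) :=
    fun l hl => by
    obtain ⟨hli, hlj⟩ := hmem l hl
    rw [S.lax_off hli.symm, S.lax_off hlj, S.aux_off hlj, S.aux_off hli.symm, ← map_mul,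
      ← map_mul, ← map_sub]
    congr 1
    have h3 := S.three_body hij hlj.symm hli
    have h3' : S.a i j * (S.b j l - S.b i l) = S.a i l * S.b l j - S.b i l * S.a l j := by
      linear_combination -h3
    rw [← smul_sub (2 * S.k / S.κ l), mul_smul_comm (2 * S.k / S.κ l) (S.a i j), h3',
      smul_mul_smul_comm, smul_mul_smul_comm, smul_smul, smul_sub]
    congr 2 <;> ring
  have hδ : S.δ i (S.aux i j) = (2 * S.k / S.κ j) • (-(2 : ℂ) • (S.a i j * S.b i j)) := by
    rw [S.aux_off hij, Derivation.map_smul, δ_b, S.δ_left_a hij, neg_smul, two_smul]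
    congr 1; ring
  rw [h1, hsplit, sum_congr rfl hT', ← map_sum, ← smul_sum, ← mul_sum, sum_sub_distrib]
  rw [S.lax_diag, S.lax_diag, S.lax_off hij, smul_mul_assoc, mul_smul_comm, S.D_mul_μ, hδ,
    ← map_mul, ← map_mul, S.aux_diag, S.aux_diag, hi, hj, S.aux_off hij]
  set X := ∑ l ∈ T, (2 * S.k / S.κ l) • S.b i l
  set Y := ∑ l ∈ T, (2 * S.k / S.κ l) • S.b j l
  simp only [mul_sub, mul_neg, neg_mul, mul_add, add_mul, smul_mul_assoc, mul_smul_comm, map_add,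
    map_neg, map_sub, map_smul, mul_comm X, mul_comm (S.b i j) (S.a i j)]
  have hk := S.k_ne_zero
  have h1 := S.κ_ne_zero i
  have h2 := S.κ_ne_zero j
  match_scalars <;> field_simp <;> try ring1
  rcases S.κ_eq i with h | h <;> rcases S.κ_eq j with h' | h' <;> rw [h, h'] <;> ring

theorem lax_pair : S.lax * (Matrix.diagonal (fun _ => S.ham) - S.aux.map S.μ) =
    (Matrix.diagonal (fun _ => S.ham) - S.aux.map S.μ) * S.lax := by
  ext i j
  rw [mul_sub, sub_mul, Matrix.sub_apply, Matrix.sub_apply, Matrix.mul_diagonal,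
    Matrix.diagonal_mul, sub_eq_sub_iff_sub_eq_sub, Matrix.mul_apply, Matrix.mul_apply,
    ← sum_sub_distrib]
  simp only [Matrix.map_apply]
  by_cases h : i = j
  · subst h; exact S.lax_diag_ham i
  · exact S.lax_off_ham h

/-- The conserved quantities. -/
def integral (r : ℕ) : E := ∑ i, ∑ j, (S.κ i)⁻¹ • (S.lax ^ r) i j

lemma aux_row_sum (i : ι) : ∑ j, S.aux i j = 0 := by
  rw [← add_sum_erase univ _ (mem_univ i), aux_diag, neg_add_eq_zero]
  exact sum_congr rfl fun j hj => (S.aux_off (ne_of_mem_erase hj).symm).symm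

lemma aux_column_sum (j : ι) : ∑ i, (S.κ i)⁻¹ • S.aux i j = 0 := by
  rw [← add_sum_erase univ _ (mem_univ j), aux_diag, smul_neg, neg_add_eq_zero, smul_sum]
  refine sum_congr rfl fun i hi => ?_
  rw [S.aux_off (ne_of_mem_erase hi), S.b_swap j i, smul_smul, smul_smul]
  congr 1
  ring

theorem integral_mul_ham (r : ℕ) : S.integral r * S.ham = S.ham * S.integral r := by
  have h : S.lax ^ r * (Matrix.diagonal (fun _ => S.ham) - S.aux.map S.μ) =
    (Matrix.diagonal (fun _ => S.ham) - S.aux.map S.μ) * S.lax ^ r :=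
    (show Commute S.lax _ from S.lax_pair).pow_left r
  have hr : ∑ i, ∑ j, (S.κ i)⁻¹ • (S.lax ^ r * S.aux.map S.μ) i j = 0 := by
    refine sum_eq_zero fun i _ => ?_
    simp only [Matrix.mul_apply, Matrix.map_apply]
    rw [← smul_sum, sum_comm]
    simp only [← mul_sum, ← map_sum, aux_row_sum, map_zero, mul_zero, sum_const_zero, smul_zero]
  have hl : ∑ i, ∑ j, (S.κ i)⁻¹ • (S.aux.map S.μ * S.lax ^ r) i j = 0 := by
    rw [sum_comm]
    refine sum_eq_zero fun j _ => ?_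
    simp only [Matrix.mul_apply, Matrix.map_apply, smul_sum]
    rw [sum_comm]
    refine sum_eq_zero fun l _ => ?_
    simp only [← smul_mul_assoc, ← map_smul, ← sum_mul, ← map_sum, aux_column_sum, map_zero,
      zero_mul]
  have := congrArg (fun M : Matrix ι ι E => ∑ i, ∑ j, (S.κ i)⁻¹ • M i j) h
  simp only [mul_sub, sub_mul, Matrix.sub_apply, smul_sub, sum_sub_distrib, hr, hl, sub_zero,
    Matrix.mul_diagonal, Matrix.diagonal_mul] at this
  simpa only [integral, sum_mul, mul_sum, smul_mul_assoc, mul_smul_comm] using this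

end MoserSystem

end

noncomputable section

open HahnSeries Pointwise Finset

namespace HahnSeries

section Operators

variable {Γ R : Type*} [AddCommGroup Γ] [LinearOrder Γ] [IsOrderedAddMonoid Γ] [CommRing R]

/-- Operators on Hahn series which shift supports by a well-ordered set of nonnegative exponents. -/
def shiftOperators (Γ R : Type*) [AddCommGroup Γ] [LinearOrder Γ] [IsOrderedAddMonoid Γ]
    [CommRing R] : Subalgebra R (Module.End R (HahnSeries Γ R)) where
  carrier := {A | ∃ S : Set Γ, S.IsPWO ∧ (∀ s ∈ S, 0 ≤ s) ∧ ∀ v, (A v).support ⊆ S + v.support}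
  mul_mem' := by
    rintro A B ⟨S, hS, hS0, hA⟩ ⟨T, hT, hT0, hB⟩
    refine ⟨S + T, hS.add hT, ?_, fun v => ?_⟩
    · rintro _ ⟨s, hs, t, ht, rfl⟩
      exact add_nonneg (hS0 s hs) (hT0 t ht)
    · rw [add_assoc]
      exact (hA (B v)).trans (Set.add_subset_add_left (hB v))
  add_mem' := by
    rintro A B ⟨S, hS, hS0, hA⟩ ⟨T, hT, hT0, hB⟩
    refine ⟨S ∪ T, hS.union hT, ?_, fun v => ?_⟩
    · rintro s (hs | hs)
      exacts [hS0 s hs, hT0 s hs]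
    · rw [Set.union_add]
      exact (support_add_subset _ _).trans (Set.union_subset_union (hA v) (hB v))
  algebraMap_mem' r := by
    refine ⟨{0}, Set.isPWO_singleton 0, by simp, fun v => ?_⟩
    rw [Set.singleton_add, Module.algebraMap_end_apply]
    simpa using support_smul_subset r v

variable {A B C H : Module.End R (HahnSeries Γ R)}

lemma coeff_apply_eq_zero (hA : A ∈ shiftOperators Γ R) {v : HahnSeries Γ R} {γ : Γ}
    (h : ∀ β ∈ v.support, β ≤ γ → (A (single β 1)).coeff γ = 0) : (A v).coeff γ = 0 := by
  obtain ⟨S, hS, hS0, hA⟩ := hA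
  classical
  let T : Finset Γ := (Finset.antidiagonal hS v.isPWO_support γ).image Prod.snd
  have hT : ∀ β, β ∈ T ↔ β ∈ v.support ∧ ∃ s ∈ S, s + β = γ := fun β => by
    simp only [T, Finset.mem_image, Finset.mem_antidiagonal, Prod.exists]
    constructor
    · rintro ⟨s, β, ⟨hs, hβ, e⟩, rfl⟩
      exact ⟨hβ, s, hs, e⟩
    · rintro ⟨hβ, s, hs, e⟩
      exact ⟨s, β, ⟨hs, hβ, e⟩, rfl⟩
  set w : HahnSeries Γ R := ∑ β ∈ T, v.coeff β • single β (1 : R) with hw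
  have hwc : ∀ β, w.coeff β = if β ∈ T then v.coeff β else 0 := fun β => by
    simp [hw, coeff_sum, coeff_single]
  have h1 : (A w).coeff γ = 0 := by
    rw [hw, map_sum, coeff_sum]
    refine sum_eq_zero fun β hβ => ?_
    obtain ⟨hv, s, hs, e⟩ := (hT β).1 hβ
    rw [map_smul, coeff_smul, h β hv (by rw [← e]; exact le_add_of_nonneg_left (hS0 s hs)),
      smul_zero]
  have h2 : (A (v - w)).coeff γ = 0 := by
    by_contra hne
    obtain ⟨s, hs, β, hβ, e⟩ := hA (v - w) hne
    rw [mem_support, coeff_sub, hwc] at hβ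
    by_cases hβT : β ∈ T
    · simp [hβT] at hβ
    · rw [if_neg hβT, sub_zero] at hβ
      exact hβT ((hT β).2 ⟨hβ, s, hs, e⟩)
  have : A v = A w + A (v - w) := by rw [← map_add, add_sub_cancel]
  rw [this, coeff_add, h1, h2, add_zero]

lemma coeff_apply_single_of_lt (hA : A ∈ shiftOperators Γ R) {β γ : Γ} (h : γ < β) :
    (A (single β 1)).coeff γ = 0 :=
  coeff_apply_eq_zero hA fun β' hβ' hle => by
    rw [eq_of_mem_support_single hβ'] at hle
    exact absurd hle h.not_ge

lemma coeff_mul_apply_single_self (hA : A ∈ shiftOperators Γ R) (hB : B ∈ shiftOperators Γ R)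
    (β : Γ) : ((A * B) (single β 1)).coeff β =
      (B (single β 1)).coeff β * (A (single β 1)).coeff β := by
  set c := (B (single β 1)).coeff β
  have h : (A (B (single β 1) - c • single β 1)).coeff β = 0 :=
    coeff_apply_eq_zero hA fun β' hβ' hle => by
      refine absurd ?_ ((mem_support _ _).1 hβ')
      rcases hle.lt_or_eq with hlt | rfl
      · simp [coeff_apply_single_of_lt hB hlt, hlt.ne]
      · simp [c]
  rwa [map_sub, coeff_sub, map_smul, coeff_smul, sub_eq_zero] at h

lemma eq_zero_of_commute [IsDomain R] {h : Γ → R} (hh : Function.Injective h)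
    (hH : ∀ v γ, (∀ β < γ, v.coeff β = 0) → (H v).coeff γ = h γ * v.coeff γ)
    (hC : C ∈ shiftOperators Γ R) (hCH : C * H = H * C)
    (hC0 : ∀ β, (C (single β 1)).coeff β = 0) : C = 0 := by
  obtain ⟨S, hS, hS0, hCS⟩ := id hC
  have hout : ∀ β γ, γ - β ∉ S → (C (single β 1)).coeff γ = 0 := fun β γ hn => by
    by_contra hne
    obtain ⟨s, hs, β', hβ', e⟩ := hCS _ hne
    rw [eq_of_mem_support_single hβ'] at e
    exact hn (by rwa [← e, add_sub_cancel_right])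
  have key : ∀ s ∈ S, ∀ β, (C (single β 1)).coeff (s + β) = 0 := fun s hs => by
    refine hS.isWF.induction hs (P := fun s => ∀ β, (C (single β 1)).coeff (s + β) = 0) ?_
    intro s hs ih β
    rcases (hS0 s hs).eq_or_lt with rfl | hpos
    · rw [zero_add]; exact hC0 β
    have ih' : ∀ β γ, γ - β < s → (C (single β 1)).coeff γ = 0 := fun β γ hlt => by
      by_cases hm : γ - β ∈ S
      · simpa using ih _ hm hlt β
      · exact hout β γ hm
    have h1 : (H (C (single β 1))).coeff (s + β) =
        h (s + β) * (C (single β 1)).coeff (s + β) :=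
      hH _ _ fun γ hγ => ih' β γ (sub_lt_iff_lt_add.2 hγ)
    have h2 : (C (H (single β 1) - h β • single β 1)).coeff (s + β) = 0 :=
      coeff_apply_eq_zero hC fun β' hβ' hle => by
        refine ih' β' (s + β) ?_
        have : β < β' := by
          by_contra hn
          refine absurd ?_ ((mem_support _ _).1 hβ')
          have hle' := not_lt.1 hn
          rw [coeff_sub, hH _ _ fun γ hγ => coeff_single_of_ne (hγ.trans_le hle').ne]
          rcases hle'.lt_or_eq with hlt | rfl
          · simp [hlt.ne]
          · simp
        rw [sub_lt_iff_lt_add]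
        exact add_lt_add_right this s
    have h3 : C (H (single β 1)) = H (C (single β 1)) := LinearMap.congr_fun hCH _
    rw [map_sub, coeff_sub, map_smul, coeff_smul, h3, h1, smul_eq_mul, ← sub_mul,
      mul_eq_zero] at h2
    refine h2.resolve_left fun he => ?_
    have := hh (sub_eq_zero.1 he)
    simp [hpos.ne'] at this
  ext v γ
  refine coeff_apply_eq_zero hC fun β _ _ => ?_
  by_cases hm : γ - β ∈ S
  · simpa using key _ hm β
  · exact hout β γ hm

/-- Shift operators commuting with a Hamiltonian of simple leading spectrum commute with each
other. -/
theorem shiftOperators_commute [IsDomain R] {h : Γ → R} (hh : Function.Injective h)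
    (hH : ∀ v γ, (∀ β < γ, v.coeff β = 0) → (H v).coeff γ = h γ * v.coeff γ)
    (hA : A ∈ shiftOperators Γ R) (hB : B ∈ shiftOperators Γ R)
    (hAH : A * H = H * A) (hBH : B * H = H * B) : A * B = B * A := by
  refine sub_eq_zero.1 (eq_zero_of_commute hh hH
    (sub_mem (mul_mem hA hB) (mul_mem hB hA)) ?_ fun β => ?_)
  · rw [sub_mul, mul_sub, mul_assoc, mul_assoc, hAH, hBH, ← mul_assoc, ← mul_assoc, ← mul_assoc,
      ← mul_assoc, hAH, hBH]
  · rw [LinearMap.sub_apply, coeff_sub, coeff_mul_apply_single_self hA hB,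
      coeff_mul_apply_single_self hB hA, mul_comm, sub_self]

/-- The diagonal operator multiplying the coefficient at `γ` by `c γ`. -/
def diagOp (c : Γ → R) : Module.End R (HahnSeries Γ R) where
  toFun v := ⟨fun γ => c γ * v.coeff γ, v.isPWO_support.mono fun γ hγ h => hγ (by simp [h])⟩
  map_add' v w := by ext; simp [mul_add]
  map_smul' r v := by ext; simp [mul_left_comm]

omit [AddCommGroup Γ] [IsOrderedAddMonoid Γ] in
@[simp] lemma coeff_diagOp (c : Γ → R) (v : HahnSeries Γ R) (γ : Γ) :
    (diagOp c v).coeff γ = c γ * v.coeff γ := rfl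

lemma diagOp_mem_shiftOperators (c : Γ → R) : diagOp c ∈ shiftOperators Γ R := by
  refine ⟨{0}, Set.isPWO_singleton 0, by simp, fun v γ hγ => ?_⟩
  rw [Set.singleton_add, Set.mem_image]
  refine ⟨γ, fun h => hγ ?_, zero_add γ⟩
  simp [h]

lemma diagOp_mul {c c₁ c₂ : Γ → R} (h : ∀ α β, c (α + β) = c₁ α + c₂ β) (f g : HahnSeries Γ R) :
    diagOp c (f * g) = diagOp c₁ f * g + f * diagOp c₂ g := by
  have hs : ∀ (c : Γ → R) (f : HahnSeries Γ R), (diagOp c f).support ⊆ f.support :=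
    fun c f γ hγ h => hγ (by simp [h])
  ext γ
  rw [coeff_diagOp, coeff_add, coeff_mul, coeff_mul_left' f.isPWO_support (hs c₁ f),
    coeff_mul_right' g.isPWO_support (hs c₂ g), mul_sum, ← sum_add_distrib]
  refine sum_congr rfl fun p hp => ?_
  rw [← (Finset.mem_antidiagonal.1 hp).2.2, h, coeff_diagOp, coeff_diagOp]
  ring

lemma mulLeft_mem_shiftOperators {f : HahnSeries Γ R} (hf : ∀ γ < 0, f.coeff γ = 0) :
    LinearMap.mulLeft R f ∈ shiftOperators Γ R :=
  ⟨f.support, f.isPWO_support, fun s hs => not_lt.1 fun h => hs (hf s h),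
    fun _ => support_mul_subset⟩

/-- Coefficientwise application of a ring homomorphism. -/
def mapHom {S : Type*} [CommRing S] (g : R →+* S) : HahnSeries Γ R →+* HahnSeries Γ S where
  toFun f := f.map g
  map_zero' := by ext; simp
  map_one' := by ext; simp [coeff_one]
  map_add' f f' := by ext; simp
  map_mul' f f' := HahnSeries.map_mul (g : R →ₙ+* S)

@[simp] lemma coeff_mapHom {S : Type*} [CommRing S] (g : R →+* S) (f : HahnSeries Γ R) (γ : Γ) :
    (mapHom g f).coeff γ = g (f.coeff γ) := rfl

end Operators

end HahnSeries

end

noncomputable section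

namespace TrigMoser

open HahnSeries

variable {N : ℕ}

/-- Laurent exponents in `N` variables, ordered lexicographically. -/
abbrev Exponent (N : ℕ) : Type := Lex (Fin N → ℤ)

/-- The field of Hahn series in which rational functions are expanded. -/
abbrev Series (N : ℕ) : Type := HahnSeries (Exponent N) ℂ

/-- The exponent of the variable `x_i`. -/
def unit (i : Fin N) : Exponent N := toLex (Pi.single i 1)

/-- The variable `x_i` as a series. -/
def var (i : Fin N) : Series N := single (unit i) 1

instance : Field (Series N) := inferInstance

instance : CharZero (Series N) :=
  charZero_of_injective_algebraMap (algebraMap ℂ (Series N)).injective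

lemma unit_lt_unit {i j : Fin N} (h : i < j) : unit j < unit i := by
  refine ⟨i, fun l hl => ?_, ?_⟩
  · simp [unit, hl.ne, (hl.trans h).ne]
  · simp [unit, h.ne]

lemma unit_injective : Function.Injective (unit : Fin N → Exponent N) :=
  fun i j h => by
    rcases lt_trichotomy i j with hl | rfl | hl
    · exact absurd h (unit_lt_unit hl).ne'
    · rfl
    · exact absurd h (unit_lt_unit hl).ne

lemma var_ne_zero (i : Fin N) : var i ≠ 0 := single_ne_zero one_ne_zero

lemma var_sub_ne_zero {i j : Fin N} (h : i ≠ j) : var i - var j ≠ 0 := fun e => by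
  have := congr_arg (fun f : Series N => f.coeff (unit i)) e
  simp [var, coeff_single_of_ne (unit_injective.ne h)] at this

/-- The Euler derivation `x_i ∂/∂x_i`. -/
def euler (i : Fin N) : Derivation ℂ (Series N) (Series N) :=
  Derivation.mk' (diagOp fun γ : Exponent N => ((ofLex γ i : ℤ) : ℂ)) fun f g => by
    rw [diagOp_mul (c₁ := fun γ : Exponent N => ((ofLex γ i : ℤ) : ℂ))
      (c₂ := fun γ : Exponent N => ((ofLex γ i : ℤ) : ℂ))
      (fun α β => by rw [ofLex_add, Pi.add_apply, Int.cast_add]), smul_eq_mul, smul_eq_mul]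
    ring

lemma coeff_euler (i : Fin N) (f : Series N) (γ : Exponent N) :
    (euler i f).coeff γ = (ofLex γ i : ℤ) * f.coeff γ := rfl

lemma euler_var_self (i : Fin N) : euler i (var i) = var i := by
  ext γ
  rw [coeff_euler]
  by_cases h : γ = unit i
  · simp [h, unit]
  · simp [var, coeff_single_of_ne h]

lemma euler_var_of_ne {i j : Fin N} (hij : i ≠ j) : euler i (var j) = 0 := by
  ext γ
  rw [coeff_euler]
  by_cases h : γ = unit j
  · simp [h, unit, hij]
  · simp [var, coeff_single_of_ne h]

/-- The function `(x_i + x_j) / (2 (x_i - x_j))`. -/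
def ratio (i j : Fin N) : Series N := (var i + var j) / (2 * (var i - var j))

lemma ratio_swap (i j : Fin N) : ratio j i = -ratio i j := by
  rw [ratio, ratio, ← neg_sub, mul_neg, div_neg, add_comm]

lemma euler_div (i : Fin N) (f g : Series N) :
    euler i (f / g) = (euler i f * g - f * euler i g) / g ^ 2 := by
  rw [Derivation.leibniz_div, smul_eq_mul, smul_eq_mul, smul_eq_mul]
  rw [div_eq_mul_inv, inv_pow]; ring

lemma euler_two_mul (i : Fin N) (f : Series N) : euler i (2 * f) = 2 * euler i f := by
  rw [two_mul, map_add, two_mul]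

lemma euler_ratio {i j : Fin N} (h : i ≠ j) :
    euler i (ratio i j) = algebraMap ℂ (Series N) (1 / 4) - ratio i j ^ 2 := by
  have h0 := var_sub_ne_zero h
  rw [ratio, euler_div, euler_two_mul, map_add, map_sub, euler_var_self, euler_var_of_ne h,
    map_div₀, map_one, map_ofNat]
  field_simp
  ring

lemma euler_ratio_of_ne {l i j : Fin N} (hi : l ≠ i) (hj : l ≠ j) :
    euler l (ratio i j) = 0 := by
  rw [ratio, euler_div, euler_two_mul, map_add, map_sub, euler_var_of_ne hi, euler_var_of_ne hj]
  simp

lemma ratio_cyclic {i j l : Fin N} (hij : i ≠ j) (hjl : j ≠ l) (hli : l ≠ i) :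
    ratio i j * ratio j l + ratio j l * ratio l i + ratio l i * ratio i j =
      -algebraMap ℂ (Series N) (1 / 4) := by
  have h1 := var_sub_ne_zero hij
  have h2 := var_sub_ne_zero hjl
  have h3 := var_sub_ne_zero hli
  rw [ratio, ratio, ratio, map_div₀, map_one, map_ofNat]
  field_simp
  ring

lemma ratio_sq {i j : Fin N} (h : i ≠ j) :
    ratio i j ^ 2 - algebraMap ℂ (Series N) (1 / 4) = var i * var j / (var i - var j) ^ 2 := by
  have h0 := var_sub_ne_zero h
  rw [ratio, map_div₀, map_one, map_ofNat]
  field_simp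
  ring


lemma orderTop_var_add {i j : Fin N} (h : i < j) {c : ℂ} (hc : c ≠ 0) :
    (var i + single (unit j) c).orderTop = unit j := by
  have h1 : (single (unit j) c).orderTop = unit j := orderTop_single hc
  have h2 : (var i).orderTop = unit i := orderTop_single one_ne_zero
  rw [orderTop_add_eq_right, h1]
  rw [h1, h2]
  exact WithTop.coe_lt_coe.2 (unit_lt_unit h)

lemma order_eq_of_orderTop {f : Series N} {γ : Exponent N} (h : f.orderTop = γ) :
    f ≠ 0 ∧ f.order = γ := by
  have h0 : f ≠ 0 := orderTop_ne_top.1 (by rw [h]; exact WithTop.coe_ne_top)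
  refine ⟨h0, WithTop.coe_injective ?_⟩
  rw [order_eq_orderTop_of_ne_zero h0, h]

lemma order_var (i : Fin N) : (var i).order = unit i := order_single one_ne_zero

lemma order_var_sub {i j : Fin N} (h : i < j) : (var i - var j).order = unit j := by
  refine (order_eq_of_orderTop ?_).2
  rw [sub_eq_add_neg, var, var, ← single_neg]
  exact orderTop_var_add h (neg_ne_zero.2 one_ne_zero)

lemma order_ratio {i j : Fin N} (h : i < j) : (ratio i j).order = 0 := by
  obtain ⟨h0, h1⟩ := order_eq_of_orderTop (orderTop_var_add h (one_ne_zero (α := ℂ)))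
  change var i + var j ≠ 0 at h0
  change (var i + var j).order = unit j at h1
  have h2 := var_sub_ne_zero h.ne
  have h3 : (2 : Series N) = single 0 2 := (map_ofNat (C (Γ := Exponent N) (R := ℂ)) 2).symm
  have h4 : (2 : Series N) ≠ 0 := two_ne_zero
  have h5 : ratio i j ≠ 0 := div_ne_zero h0 (mul_ne_zero h4 h2)
  have h6 : ratio i j * (2 * (var i - var j)) = var i + var j :=
    div_mul_cancel₀ _ (mul_ne_zero h4 h2)
  have h7 := congr_arg order h6
  rw [order_mul h5 (mul_ne_zero h4 h2), order_mul h4 h2, h1, order_var_sub h, h3,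
    order_single two_ne_zero, zero_add] at h7
  simpa using h7

lemma coeff_ratio_of_neg (i j : Fin N) {γ : Exponent N} (hγ : γ < 0) :
    (ratio i j).coeff γ = 0 := by
  rcases lt_trichotomy i j with h | rfl | h
  · exact coeff_eq_zero_of_lt_order (by rwa [order_ratio h])
  · simp [ratio]
  · rw [ratio_swap, HahnSeries.coeff_neg, coeff_eq_zero_of_lt_order (by rwa [order_ratio h]),
      neg_zero]

lemma coeff_ratio_sq_of_nonpos {i j : Fin N} (h : i < j) {γ : Exponent N} (hγ : γ ≤ 0) :
    (ratio i j ^ 2 - algebraMap ℂ (Series N) (1 / 4)).coeff γ = 0 := by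
  refine coeff_eq_zero_of_lt_order (hγ.trans_lt ?_)
  rw [ratio_sq h.ne]
  have h1 := pow_ne_zero 2 (var_sub_ne_zero h.ne)
  have h2 := mul_ne_zero (var_ne_zero i) (var_ne_zero j)
  have h3 := congr_arg order (div_mul_cancel₀ (var i * var j) h1)
  rw [order_mul (div_ne_zero h2 h1) h1, order_mul (var_ne_zero i) (var_ne_zero j), order_pow,
    order_var_sub h, order_var, order_var, two_smul, ← add_assoc] at h3
  have h4 := add_right_cancel h3
  by_contra hn
  have h5 := add_le_add_left (not_lt.1 hn) (unit j)
  rw [h4, zero_add] at h5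
  exact h5.not_gt (unit_lt_unit h)

/-- The ring of polynomials in the spectral parameters. -/
abbrev Param (N : ℕ) : Type := MvPolynomial (Fin N) ℂ

/-- Series with coefficients depending polynomially on the spectral parameters. -/
abbrev ParamSeries (N : ℕ) : Type := HahnSeries (Exponent N) (Param N)

/-- Operators on series with parameters. -/
abbrev Op (N : ℕ) : Type := Module.End (Param N) (ParamSeries N)

/-- Series viewed as series with parameters. -/
def extend : Series N →+* ParamSeries N := mapHom MvPolynomial.C

/-- Multiplication operators. -/
def mulOp : Series N →ₐ[ℂ] Op N where
  toRingHom := (Algebra.lmul (Param N) (ParamSeries N)).toRingHom.comp extend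
  commutes' c := by
    refine LinearMap.ext fun v => HahnSeries.ext (funext fun γ => ?_)
    have h : extend (algebraMap ℂ (Series N) c) = HahnSeries.C (MvPolynomial.C c) := by
      ext1; funext γ
      rw [extend, coeff_mapHom, HahnSeries.algebraMap_apply]
      simp [HahnSeries.coeff_single, apply_ite MvPolynomial.C]
    change (extend (algebraMap ℂ (Series N) c) * v).coeff γ = c • v.coeff γ
    rw [h, HahnSeries.C_mul_eq_smul, HahnSeries.coeff_smul, smul_eq_mul, MvPolynomial.smul_eq_C_mul]

@[simp] lemma mulOp_apply (f : Series N) (v : ParamSeries N) : mulOp f v = extend f * v := rfl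

/-- The Euler operator `x_i ∂/∂x_i + λ_i`, with `λ_i` a spectral parameter. -/
def eulerOp (i : Fin N) : Op N :=
  diagOp fun γ => ((ofLex γ i : ℤ) : Param N) + MvPolynomial.X i

lemma eulerOp_mul_mulOp (i : Fin N) (f : Series N) :
    eulerOp i * mulOp f = mulOp f * eulerOp i + mulOp (euler i f) := by
  refine LinearMap.ext fun v => ?_
  have h : extend (euler i f) =
      diagOp (fun γ : Exponent N => ((ofLex γ i : ℤ) : Param N)) (extend f) := by
    ext1; funext γ
    rw [coeff_diagOp, extend, coeff_mapHom, coeff_mapHom, coeff_euler, map_mul, map_intCast]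
  change eulerOp i (extend f * v) = extend f * eulerOp i v + extend (euler i f) * v
  rw [h, add_comm]
  refine diagOp_mul (fun α β => ?_) _ _
  rw [ofLex_add, Pi.add_apply, Int.cast_add, add_assoc]

lemma eulerOp_comm (i j : Fin N) : eulerOp i * eulerOp j = eulerOp j * eulerOp i := by
  refine LinearMap.ext fun v => HahnSeries.ext (funext fun γ => ?_)
  exact mul_left_comm _ _ _

/-- The trigonometric Moser system with masses `κ`. -/
def system (k : ℂ) (hk : k ≠ 0) (κ : Fin N → ℂ) (hκ : ∀ i, κ i = 1 ∨ κ i = k) :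
    MoserSystem (Fin N) (Series N) (Op N) where
  k := k
  κ := κ
  μ := mulOp
  δ := euler
  D := eulerOp
  a := ratio
  k_ne_zero := hk
  κ_eq := hκ
  D_mul_μ := eulerOp_mul_mulOp
  D_comm := eulerOp_comm
  a_swap := ratio_swap
  δ_a _ _ := euler_ratio
  δ_a_of_ne _ _ _ := euler_ratio_of_ne
  a_cyclic _ _ _ := ratio_cyclic

section Commute

variable (k : ℂ) (hk : k ≠ 0) (κ : Fin N → ℂ) (hκ : ∀ i, κ i = 1 ∨ κ i = k)

lemma smul_mem_shiftOperators (c : ℂ) {A : Op N}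
    (hA : A ∈ shiftOperators (Exponent N) (Param N)) :
    c • A ∈ shiftOperators (Exponent N) (Param N) := by
  rw [← algebraMap_smul (Param N) c A]
  exact Subalgebra.smul_mem _ hA _

lemma lax_mem (i j : Fin N) :
    (system k hk κ hκ).lax i j ∈ shiftOperators (Exponent N) (Param N) := by
  rw [MoserSystem.lax]
  split_ifs
  · exact smul_mem_shiftOperators _ (diagOp_mem_shiftOperators _)
  · rw [map_smul]
    refine smul_mem_shiftOperators _ (mulLeft_mem_shiftOperators fun γ hγ => ?_)
    change MvPolynomial.C ((ratio i j).coeff γ) = 0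
    rw [coeff_ratio_of_neg i j hγ, map_zero]

lemma lax_pow_mem (r : ℕ) (i j : Fin N) :
    ((system k hk κ hκ).lax ^ r) i j ∈ shiftOperators (Exponent N) (Param N) := by
  induction r generalizing i j with
  | zero =>
    rw [pow_zero, Matrix.one_apply]
    split_ifs
    exacts [one_mem _, zero_mem _]
  | succ r ih =>
    rw [pow_succ, Matrix.mul_apply]
    exact sum_mem fun l _ => mul_mem (ih i l) (lax_mem k hk κ hκ l j)

lemma integral_mem (r : ℕ) :
    (system k hk κ hκ).integral r ∈ shiftOperators (Exponent N) (Param N) :=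
  sum_mem fun i _ => sum_mem fun j _ =>
    smul_mem_shiftOperators _ (lax_pow_mem k hk κ hκ r i j)

/-- The leading eigenvalues of the Hamiltonian. -/
def symbol (κ : Fin N → ℂ) (γ : Exponent N) : Param N :=
  ∑ i, MvPolynomial.C (κ i) * (((ofLex γ i : ℤ) : Param N) + MvPolynomial.X i) ^ 2

lemma eval_pderiv_symbol (γ : Exponent N) (i : Fin N) :
    MvPolynomial.eval 0 (pderiv i (symbol κ γ)) = 2 * κ i * (ofLex γ i : ℤ) := by
  have h : ∀ l, MvPolynomial.eval 0 (pderiv i (MvPolynomial.C (κ l) *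
      (((ofLex γ l : ℤ) : Param N) + MvPolynomial.X l) ^ 2)) =
        if l = i then 2 * κ i * (ofLex γ i : ℤ) else 0 := fun l => by
    split_ifs with hl
    · subst hl
      simp [sq]
      ring
    · simp [sq, pderiv_X_of_ne hl]
  rw [symbol, map_sum, map_sum, Finset.sum_congr rfl fun l _ => h l]
  simp

lemma symbol_injective (hκ : ∀ i, κ i ≠ 0) : Function.Injective (symbol κ) := by
  intro α β h
  refine ofLex.injective (funext fun i => ?_)
  have h1 := eval_pderiv_symbol κ α i
  rw [h, eval_pderiv_symbol] at h1
  exact_mod_cast (mul_left_cancel₀ (mul_ne_zero two_ne_zero (hκ i)) h1).symm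

lemma coeff_pot_of_nonpos {γ : Exponent N} (hγ : γ ≤ 0) :
    ((system k hk κ hκ).pot).coeff γ = 0 := by
  rw [MoserSystem.pot, HahnSeries.coeff_sum]
  refine Finset.sum_eq_zero fun i _ => ?_
  rw [HahnSeries.coeff_sum]
  refine Finset.sum_eq_zero fun j _ => ?_
  split_ifs with h
  · rw [HahnSeries.coeff_smul, show (system k hk κ hκ).b i j = _ from rfl, MoserSystem.b]
    exact (congr_arg _ (coeff_ratio_sq_of_nonpos h hγ)).trans (smul_zero _)
  · rfl

lemma coeff_ham (v : ParamSeries N) (γ : Exponent N) (hv : ∀ β < γ, v.coeff β = 0) :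
    ((system k hk κ hκ).ham v).coeff γ = symbol κ γ * v.coeff γ := by
  have h : (extend (system k hk κ hκ).pot * v).coeff γ = 0 := by
    rw [HahnSeries.coeff_mul]
    refine Finset.sum_eq_zero fun p hp => ?_
    obtain ⟨h1, -, h3⟩ := Finset.mem_antidiagonal.1 hp
    rw [hv p.2, mul_zero]
    rw [← h3]
    refine lt_add_of_pos_left _ (not_le.1 fun hn => h1 ?_)
    rw [extend, coeff_mapHom, coeff_pot_of_nonpos k hk κ hκ hn, map_zero]
  rw [MoserSystem.ham, LinearMap.sub_apply, HahnSeries.coeff_sub, LinearMap.sum_apply,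
    HahnSeries.coeff_sum]
  refine (congr_arg₂ _ rfl h).trans ?_
  rw [sub_zero, symbol, Finset.sum_mul]
  refine Finset.sum_congr rfl fun i _ => ?_
  rw [LinearMap.smul_apply, HahnSeries.coeff_smul, MvPolynomial.smul_eq_C_mul, sq, mul_assoc,
    mul_assoc]
  rfl

theorem integral_commute (r s : ℕ) :
    (system k hk κ hκ).integral r * (system k hk κ hκ).integral s =
      (system k hk κ hκ).integral s * (system k hk κ hκ).integral r :=
  shiftOperators_commute (symbol_injective κ (system k hk κ hκ).κ_ne_zero)
    (coeff_ham k hk κ hκ) (integral_mem k hk κ hκ r) (integral_mem k hk κ hκ s)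
    ((system k hk κ hκ).integral_mul_ham r) ((system k hk κ hκ).integral_mul_ham s)

end Commute

section Expansion

variable {N : ℕ}

lemma prod_single (s : Finset (Fin N)) (g : Fin N → Exponent N) :
    ∏ i ∈ s, (single (g i) 1 : Series N) = single (∑ i ∈ s, g i) 1 := by
  induction s using Finset.cons_induction with
  | empty => rfl
  | cons i s hi ih => rw [Finset.prod_cons, ih, single_mul_single, one_mul, Finset.sum_cons]

/-- The exponent of a monomial. -/
def exponent (s : Fin N →₀ ℕ) : Exponent N := toLex fun i => (s i : ℤ)

lemma exponent_injective : Function.Injective (exponent (N := N)) := fun s t h =>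
  Finsupp.ext fun i => by
    have := congr_fun (toLex.injective h) i
    exact_mod_cast this

/-- Expansion of polynomials into series. -/
def expandPoly : MvPolynomial (Fin N) ℂ →ₐ[ℂ] Series N := MvPolynomial.aeval var

lemma expandPoly_C (c : ℂ) :
    expandPoly (N := N) (MvPolynomial.C c) = algebraMap ℂ (Series N) c :=
  MvPolynomial.aeval_C _ c

lemma expandPoly_X (i : Fin N) : expandPoly (MvPolynomial.X i) = var i := MvPolynomial.aeval_X _ i

lemma expandPoly_monomial (s : Fin N →₀ ℕ) (c : ℂ) :
    expandPoly (MvPolynomial.monomial s c) = single (exponent s) c := by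
  have h : ∀ i, (var i : Series N) ^ s i = single (s i • unit i) 1 := fun i => by
    rw [var, HahnSeries.single_pow, one_pow]
  have h' : ∑ i, s i • unit i = exponent s := by
    refine ofLex.injective (funext fun l => ?_)
    change (∑ i, s i • (ofLex (unit i) : Fin N → ℤ)) l = _
    rw [Finset.sum_apply, Finset.sum_eq_single l]
    · simp [unit, exponent]
    · intro i _ hi
      simp [unit, hi.symm]
    · simp
  rw [expandPoly, MvPolynomial.aeval_monomial, Finsupp.prod_fintype _ _ fun i => pow_zero _,
    Finset.prod_congr rfl fun i _ => h i, prod_single, h', HahnSeries.algebraMap_apply]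
  simp

lemma coeff_expandPoly (p : MvPolynomial (Fin N) ℂ) (s : Fin N →₀ ℕ) :
    (expandPoly p).coeff (exponent s) = MvPolynomial.coeff s p := by
  induction p using MvPolynomial.induction_on' with
  | monomial t c =>
    rw [expandPoly_monomial, HahnSeries.coeff_single, MvPolynomial.coeff_monomial]
    simp only [exponent_injective.eq_iff, eq_comm]
  | add p q hp hq => rw [map_add, HahnSeries.coeff_add, hp, hq, MvPolynomial.coeff_add]

lemma expandPoly_injective : Function.Injective (expandPoly (N := N)) :=
  fun p q h => MvPolynomial.ext _ _ fun s => by rw [← coeff_expandPoly, h, coeff_expandPoly]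

lemma euler_expandPoly (i : Fin N) (p : MvPolynomial (Fin N) ℂ) :
    euler i (expandPoly p) = var i * expandPoly (pderiv i p) := by
  induction p using MvPolynomial.induction_on with
  | C c => rw [expandPoly_C, Derivation.map_algebraMap, pderiv_C, map_zero, mul_zero]
  | add p q hp hq => rw [map_add, map_add, hp, hq, map_add, map_add, mul_add]
  | mul_X p j hp =>
    rw [map_mul, Derivation.leibniz, hp, Derivation.leibniz, expandPoly_X, smul_eq_mul, smul_eq_mul,
      smul_eq_mul, smul_eq_mul, map_add, map_mul, map_mul, expandPoly_X]
    by_cases h : i = j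
    · subst h
      rw [euler_var_self, pderiv_X_self, map_one]
      ring
    · rw [euler_var_of_ne h, pderiv_X_of_ne (Ne.symm h), map_zero]
      ring

/-- Specialisation of the spectral parameters to zero. -/
def specialize : ParamSeries N →+* Series N := mapHom (MvPolynomial.eval 0)

lemma specialize_extend (f : Series N) : specialize (extend f) = f :=
  HahnSeries.ext (funext fun _ => MvPolynomial.eval_C _)

lemma specialize_mulOp (f : Series N) (v : ParamSeries N) :
    specialize (mulOp f v) = f * specialize v := by
  rw [mulOp_apply, map_mul, specialize_extend]

lemma specialize_eulerOp (i : Fin N) (v : ParamSeries N) :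
    specialize (eulerOp i v) = euler i (specialize v) := by
  ext γ
  rw [coeff_euler, specialize, coeff_mapHom, coeff_mapHom, eulerOp, coeff_diagOp, map_mul]
  simp

lemma specialize_smul (c : ℂ) (v : ParamSeries N) :
    specialize (c • v) = algebraMap ℂ (Series N) c * specialize v := by
  rw [← Algebra.smul_def]
  ext γ
  rw [HahnSeries.coeff_smul, specialize, coeff_mapHom, coeff_mapHom, HahnSeries.coeff_smul,
    MvPolynomial.smul_eq_C_mul, map_mul, MvPolynomial.eval_C, smul_eq_mul]

end Expansion

section Transport

variable (n m : ℕ)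

/-- Expansion of rational functions into series. -/
def expand : F n m →+* Series (n + m) :=
  IsFractionRing.lift (A := PR n m) (K := F n m)
    (g := expandPoly.toRingHom) expandPoly_injective

lemma expand_emb (p : PR n m) : expand n m (emb n m p) = expandPoly p :=
  IsFractionRing.lift_algebraMap expandPoly_injective p

lemma expand_xi (i : Fin (n + m)) : expand n m (xi n m i) = var i := by
  rw [xi, expand_emb, expandPoly_X]

lemma expand_cc (c : ℂ) : expand n m (cc n m c) = algebraMap ℂ _ c := by
  rw [cc, expand_emb, expandPoly_C]

lemma den_ne_zero (z : F n m) : den n m z ≠ 0 :=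
  nonZeroDivisors.ne_zero (IsLocalization.sec (nonZeroDivisors (PR n m)) z).2.2

lemma expand_den_ne_zero (z : F n m) : expandPoly (den n m z) ≠ (0 : Series (n + m)) :=
  fun h => den_ne_zero n m z (expandPoly_injective (by rw [h, map_zero]))

lemma expand_eq (z : F n m) :
    expand n m z = expandPoly (num n m z) / expandPoly (den n m z) := by
  rw [eq_div_iff (expand_den_ne_zero n m z), ← expand_emb, ← expand_emb, ← map_mul]
  exact congr_arg _ (IsLocalization.sec_spec (nonZeroDivisors (PR n m)) z)

lemma expand_euler (i : Fin (n + m)) (z : F n m) :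
    expand n m (xi n m i * fder n m i z) = euler i (expand n m z) := by
  rw [expand_eq n m z, euler_div, euler_expandPoly, euler_expandPoly, map_mul, expand_xi, fder,
    map_div₀, map_sub, map_mul, map_mul, map_pow]
  simp only [expand_emb]
  ring

/-- The mass parameters of the deformed system. -/
def mass (k : ℂ) (i : Fin (n + m)) : ℂ := if (i : ℕ) < n then 1 else k

lemma mass_eq (k : ℂ) (i : Fin (n + m)) : mass n m k i = 1 ∨ mass n m k i = k :=
  ite_eq_or_eq _ _ _

variable {k : ℂ} (hk : k ≠ 0)

/-- The Moser system attached to the deformed operator. -/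
abbrev deformed : MoserSystem (Fin (n + m)) (Series (n + m)) (Op (n + m)) :=
  system k hk (mass n m k) (mass_eq n m k)

variable {n m} {z : F n m} {v : ParamSeries (n + m)} (hz : expand n m z = specialize v)

include hz

lemma expand_LmatT (i j : Fin (n + m)) :
    expand n m (LmatT n m k i j z) = specialize ((deformed n m hk).lax i j v) := by
  rw [LmatT]
  by_cases h : i = j
  · subst h
    rw [if_pos rfl, MoserSystem.lax_diag, LinearMap.smul_apply, specialize_smul]
    change _ = algebraMap ℂ _ (mass n m k i) * specialize (eulerOp i v)
    rw [specialize_eulerOp, map_mul, expand_euler, hz, map_zpow₀, expand_cc, pE, mass]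
    split_ifs <;> simp
  · rw [if_neg h, MoserSystem.lax_off _ h, map_smul, LinearMap.smul_apply, specialize_smul]
    change _ = algebraMap ℂ _ (k / mass n m k j) * specialize (mulOp (ratio i j) v)
    have h0 := var_sub_ne_zero h
    have h1 : algebraMap ℂ (Series (n + m)) k ≠ 0 := by simpa using hk
    rw [specialize_mulOp, ratio]
    simp only [map_mul, map_add, map_sub, map_inv₀, map_div₀, map_zpow₀, expand_cc, expand_xi, hz,
      pE, mass, map_one, map_ofNat]
    split_ifs <;> simp <;> field_simp

lemma expand_mpow (r : ℕ) (i j : Fin (n + m)) :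
    expand n m (mpow (LmatT n m k) r i j z) = specialize (((deformed n m hk).lax ^ r) i j v) := by
  induction r generalizing i j with
  | zero =>
    rw [pow_zero, Matrix.one_apply]
    change expand n m (if i = j then z else 0) = _
    split_ifs
    · exact hz
    · rw [map_zero]; exact (map_zero _).symm
  | succ r ih =>
    rw [pow_succ', Matrix.mul_apply, LinearMap.sum_apply, map_sum]
    change expand n m (∑ l, LmatT n m k i l (mpow (LmatT n m k) r l j z)) = _
    rw [map_sum]
    exact Finset.sum_congr rfl fun l _ => expand_LmatT hk (ih l j) i l

lemma expand_LopT (r : ℕ) :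
    expand n m (LopT n m k r z) = specialize ((deformed n m hk).integral r v) := by
  rw [LopT, MoserSystem.integral]
  simp only [map_sum, LinearMap.sum_apply, map_mul, LinearMap.smul_apply, specialize_smul]
  refine Finset.sum_congr rfl fun i _ => Finset.sum_congr rfl fun j _ => ?_
  rw [expand_mpow hk hz]
  change _ = algebraMap ℂ _ (mass n m k i)⁻¹ * _
  rw [map_zpow₀, expand_cc, pE, mass]
  split_ifs <;> simp

lemma expand_HnmT : expand n m (HnmT n m k z) = specialize ((deformed n m hk).ham v) := by
  rw [HnmT, sub_sub, sub_sub, ← add_mul, ← add_mul, map_sub, map_mul, hz, MoserSystem.ham,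
    LinearMap.sub_apply, map_sub]
  change _ = _ - specialize (mulOp (deformed n m hk).pot v)
  rw [specialize_mulOp]
  refine congr_arg₂ _ ?_ (congr_arg (· * _) ?_)
  · rw [Finset.sum_filter, Finset.sum_filter, Finset.mul_sum, ← Finset.sum_add_distrib, map_sum,
      LinearMap.sum_apply, map_sum]
    refine Finset.sum_congr rfl fun i _ => ?_
    rw [LinearMap.smul_apply, specialize_smul]
    change _ = algebraMap ℂ _ (mass n m k i) * specialize (eulerOp i (eulerOp i v))
    rw [specialize_eulerOp, specialize_eulerOp, ← hz, ← expand_euler, ← expand_euler, mass]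
    by_cases h : (i : ℕ) < n
    · simp [h]
    · simp [h, not_lt.1 h, expand_cc]
  · rw [MoserSystem.pot]
    simp only [← Finset.sum_add_distrib, map_sum]
    refine Finset.sum_congr rfl fun i _ => Finset.sum_congr rfl fun j _ => ?_
    have h2 : expand n m 2 = 2 := map_ofNat _ 2
    have h2' : algebraMap ℂ (Series (n + m)) 2 = 2 := map_ofNat _ 2
    have hk' : algebraMap ℂ (Series (n + m)) k ≠ 0 := by simpa using hk
    by_cases h : i < j
    · have hb : (deformed n m hk).b i j = var i * var j / (var i - var j) ^ 2 := ratio_sq h.ne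
      have hc : (deformed n m hk).coupling i j =
        2 * k * (k + 1) / (mass n m k i * mass n m k j) := rfl
      rw [if_pos h, hb, hc, Algebra.smul_def, mass, mass]
      rw [Fin.lt_def] at h
      have h0 : var i - var j ≠ 0 := var_sub_ne_zero (Fin.ne_of_lt h)
      by_cases hj : (j : ℕ) < n
      · have hi : (i : ℕ) < n := h.trans hj
        simp [h, hi, hj, not_le.2 hi, not_le.2 hj, h2, h2', expand_cc, expand_xi]
        field_simp
      · by_cases hi : (i : ℕ) < n
        · simp [h, hi, hj, not_le.2 hi, not_lt.1 hj, h2, h2', expand_cc, expand_xi]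
          field_simp
        · simp [h, hi, hj, not_lt.1 hi, h2, h2', expand_cc, expand_xi]
          field_simp
          ring
    · rw [if_neg h]
      rw [Fin.lt_def] at h
      rw [if_neg (fun h' => h h'.1), if_neg (fun h' => h h'.2),
        if_neg (fun h' => h (h'.1.trans_le h'.2))]
      simp

end Transport

end TrigMoser

end

/-- for every r ≥ 1, L^{(r)}_{n,m} = e*·L^r·e commutes with the deformed
trigonometric CMS operator, and moreover these operators commute with each other. -/
theorem deformed_trig_trace_powers_commute (n m : ℕ) (k : ℂ) (hk : k ≠ 0) :
    (∀ r : ℕ, 1 ≤ r → ∀ z : F n m,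
        LopT n m k r (HnmT n m k z) = HnmT n m k (LopT n m k r z)) ∧
    (∀ r s : ℕ, 1 ≤ r → 1 ≤ s → ∀ z : F n m,
        LopT n m k r (LopT n m k s z) = LopT n m k s (LopT n m k r z)) := by
  have hz (z : F n m) :=
    (TrigMoser.specialize_extend (TrigMoser.expand n m z)).symm
  refine ⟨fun r _ z => (TrigMoser.expand n m).injective ?_,
    fun r s _ _ z => (TrigMoser.expand n m).injective ?_⟩
  · rw [TrigMoser.expand_LopT hk (TrigMoser.expand_HnmT hk (hz z)),
      TrigMoser.expand_HnmT hk (TrigMoser.expand_LopT hk (hz z) r)]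
    exact congr_arg _ (LinearMap.congr_fun ((TrigMoser.deformed n m hk).integral_mul_ham r) _)
  · rw [TrigMoser.expand_LopT hk (TrigMoser.expand_LopT hk (hz z) s),
      TrigMoser.expand_LopT hk (TrigMoser.expand_LopT hk (hz z) r)]
    exact congr_arg _ (LinearMap.congr_fun (TrigMoser.integral_commute k hk _ _ r s) _)
end
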